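/- arXiv:1611.08180 — 5 statements merged into one kernel-verified Lean document; each statement's English description precedes it below -/
import Mathlib

section
/- For all sufficiently large integers N, the number of positive integers n ≤ N satisfying |s_3(n) - s_2(n)| ≤ 0.1457205 · log n is greater than N^0.970359. -/
open Filter Finset

/-- `digitSum b n` is the sum of the digits of `n` in base `b`. -/
def digitSum (b n : ℕ) : ℕ := (Nat.digits b n).sum

theorem sum_range_mul_eq {M : Type*} [AddCommMonoid M] (f : ℕ → M) (b m : ℕ) :
    ∑ n ∈ range (m * b), f n = ∑ i ∈ range m, ∑ d ∈ range b, f (d + b * i) := by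
  induction m with
  | zero => simp
  | succ m ih =>
    rw [Nat.succ_mul, Finset.sum_range_add, ih, Finset.sum_range_succ]
    simp only [mul_comm, add_comm]

theorem digitSum_add_mul {b d : ℕ} (hb : 1 < b) (hd : d < b) (m : ℕ) :
    digitSum b (d + b * m) = digitSum b m + d := by
  unfold digitSum
  by_cases h : d ≠ 0 ∨ m ≠ 0
  · rw [Nat.digits_add b hb d m hd h, List.sum_cons, add_comm]
  · push Not at h
    simp [h.1, h.2]

theorem sum_range_pow_succ_digitSum {M : Type*} [AddCommMonoid M] {b : ℕ} (hb : 1 < b)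
    (g : ℕ → M) (k : ℕ) :
    ∑ n ∈ range (b ^ (k + 1)), g (digitSum b n) =
      ∑ m ∈ range (b ^ k), ∑ d ∈ range b, g (digitSum b m + d) := by
  rw [pow_succ, sum_range_mul_eq]
  refine sum_congr rfl fun m _ => sum_congr rfl fun d hd => ?_
  rw [digitSum_add_mul hb (mem_range.1 hd)]

theorem digitSum_pow_add {b : ℕ} (hb : 1 < b) (k : ℕ) :
    ∀ m < b ^ k, digitSum b (b ^ k + m) = digitSum b m + 1 := by
  induction k with
  | zero =>
    intro m hm
    have h0 : m = 0 := by simpa using hm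
    subst h0
    simpa [digitSum] using digitSum_add_mul hb hb 0
  | succ k ih =>
    intro m hm
    have hlt : m % b < b := Nat.mod_lt _ (by lia)
    have hdiv : m / b < b ^ k := by
      apply Nat.div_lt_of_lt_mul
      rwa [pow_succ, mul_comm] at hm
    have hm' : m = m % b + b * (m / b) := (Nat.mod_add_div m b).symm
    have hsum : b ^ (k + 1) + m = m % b + b * (b ^ k + m / b) := by
      conv_lhs => rw [hm']
      ring
    rw [hsum, digitSum_add_mul hb hlt, ih _ hdiv]
    conv_rhs => rw [hm', digitSum_add_mul hb hlt]
    ring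

theorem sum_exp_digitSum_two (θ : ℝ) (K : ℕ) :
    ∑ n ∈ range (2 ^ K), Real.exp (θ * digitSum 2 n) = (1 + Real.exp θ) ^ K := by
  induction K with
  | zero => simp [digitSum]
  | succ K ih =>
    rw [sum_range_pow_succ_digitSum (by norm_num) (fun s : ℕ => Real.exp (θ * s)), pow_succ, ← ih,
      sum_mul]
    refine sum_congr rfl fun m _ => ?_
    simp only [sum_range_succ, range_zero, sum_empty]
    push_cast
    rw [add_zero, zero_add, mul_add, mul_one, Real.exp_add]
    ring

/-- Chernoff bound for the binary sum of digits; the sign of `θ` selects the tail. -/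
theorem card_digitSum_two_tail_le (θ t : ℝ) (K : ℕ) :
    (((range (2 ^ K)).filter (fun n => θ * t ≤ θ * digitSum 2 n)).card : ℝ) * Real.exp (θ * t) ≤
      (1 + Real.exp θ) ^ K := by
  rw [← sum_exp_digitSum_two, ← nsmul_eq_mul]
  refine le_trans (card_nsmul_le_sum _ (fun n => Real.exp (θ * digitSum 2 n)) _ ?_) ?_
  · intro n hn
    exact Real.exp_le_exp.2 (mem_filter.1 hn).2
  · exact sum_le_sum_of_subset_of_nonneg (filter_subset _ _) fun _ _ _ => (Real.exp_pos _).le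

theorem sum_pow_digitSum_three (x : ℝ) (k : ℕ) :
    ∑ n ∈ range (3 ^ k), x ^ digitSum 3 n = (1 + x + x ^ 2) ^ k := by
  induction k with
  | zero => simp [digitSum]
  | succ k ih =>
    rw [sum_range_pow_succ_digitSum (by norm_num) (fun s : ℕ => x ^ s), pow_succ, ← ih, sum_mul]
    refine sum_congr rfl fun m _ => ?_
    simp only [sum_range_succ, range_zero, sum_empty]
    ring

theorem sum_centered_mul_pow_digitSum_three {x μ : ℝ}
    (hμ : x + 2 * x ^ 2 = μ * (1 + x + x ^ 2)) (k : ℕ) :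
    ∑ n ∈ range (3 ^ k), ((digitSum 3 n : ℝ) - μ * k) * x ^ digitSum 3 n = 0 := by
  induction k with
  | zero => simp [digitSum]
  | succ k ih =>
    rw [sum_range_pow_succ_digitSum (by norm_num)
      (fun s : ℕ => ((s : ℝ) - μ * ((k + 1 : ℕ) : ℝ)) * x ^ s)]
    have h : ∀ m ∈ range (3 ^ k), ∑ d ∈ range 3,
        (((digitSum 3 m + d : ℕ) : ℝ) - μ * ((k + 1 : ℕ) : ℝ)) * x ^ (digitSum 3 m + d) =
        (1 + x + x ^ 2) * (((digitSum 3 m : ℝ) - μ * k) * x ^ digitSum 3 m) := by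
      intro m _
      simp only [sum_range_succ, range_zero, sum_empty]
      push_cast
      linear_combination x ^ digitSum 3 m * hμ
    rw [sum_congr rfl h, ← mul_sum, ih, mul_zero]

theorem sum_centered_sq_mul_pow_digitSum_three {x μ v : ℝ}
    (hμ : x + 2 * x ^ 2 = μ * (1 + x + x ^ 2))
    (hv : μ ^ 2 + (1 - μ) ^ 2 * x + (2 - μ) ^ 2 * x ^ 2 = v * (1 + x + x ^ 2)) (k : ℕ) :
    ∑ n ∈ range (3 ^ k), ((digitSum 3 n : ℝ) - μ * k) ^ 2 * x ^ digitSum 3 n =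
      k * v * (1 + x + x ^ 2) ^ k := by
  induction k with
  | zero => simp [digitSum]
  | succ k ih =>
    rw [sum_range_pow_succ_digitSum (by norm_num)
      (fun s : ℕ => ((s : ℝ) - μ * ((k + 1 : ℕ) : ℝ)) ^ 2 * x ^ s)]
    have h : ∀ m ∈ range (3 ^ k), ∑ d ∈ range 3,
        (((digitSum 3 m + d : ℕ) : ℝ) - μ * ((k + 1 : ℕ) : ℝ)) ^ 2 * x ^ (digitSum 3 m + d) =
        (1 + x + x ^ 2) * (((digitSum 3 m : ℝ) - μ * k) ^ 2 * x ^ digitSum 3 m) +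
          v * (1 + x + x ^ 2) * x ^ digitSum 3 m := by
      intro m _
      simp only [sum_range_succ, range_zero, sum_empty]
      push_cast
      linear_combination x ^ digitSum 3 m * hv +
        2 * ((digitSum 3 m : ℝ) - μ * k) * x ^ digitSum 3 m * hμ
    rw [sum_congr rfl h, sum_add_distrib, ← mul_sum, ← mul_sum, ih, sum_pow_digitSum_three]
    push_cast
    ring

/-- Integers below `3 ^ k` whose ternary sum of digits lies within `ε k` of the mean `μ k` of the
distribution tilted by `x = exp (-ℓ)`. -/
theorem card_digitSum_three_window_ge {ℓ μ v ε : ℝ} (hℓ : 0 < ℓ) (hε : 0 < ε)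
    (hμ : Real.exp (-ℓ) + 2 * Real.exp (-ℓ) ^ 2 =
      μ * (1 + Real.exp (-ℓ) + Real.exp (-ℓ) ^ 2))
    (hv : μ ^ 2 + (1 - μ) ^ 2 * Real.exp (-ℓ) + (2 - μ) ^ 2 * Real.exp (-ℓ) ^ 2 =
      v * (1 + Real.exp (-ℓ) + Real.exp (-ℓ) ^ 2)) {k : ℕ} (hk : 2 * v ≤ ε ^ 2 * k)
    (hk0 : 0 < k) :
    Real.exp (k * (Real.log (1 + Real.exp (-ℓ) + Real.exp (-ℓ) ^ 2) + ℓ * (μ - ε))) / 2 ≤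
      (((range (3 ^ k)).filter
        (fun m => |(digitSum 3 m : ℝ) - μ * k| ≤ ε * k)).card : ℝ) := by
  set x := Real.exp (-ℓ) with hx
  have hx0 : 0 < x := Real.exp_pos _
  set P := 1 + x + x ^ 2 with hP
  have hP0 : 0 < P := by positivity
  have hkR : (0 : ℝ) < k := by exact_mod_cast hk0
  have hsplit := sum_filter_add_sum_filter_not (range (3 ^ k))
    (fun m => |(digitSum 3 m : ℝ) - μ * k| ≤ ε * k) (fun m => x ^ digitSum 3 m)
  rw [sum_pow_digitSum_three] at hsplit
  have htail : (∑ m ∈ (range (3 ^ k)).filter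
      (fun m => ¬ |(digitSum 3 m : ℝ) - μ * k| ≤ ε * k), x ^ digitSum 3 m) * (ε * k) ^ 2 ≤
      k * v * P ^ k := by
    rw [← sum_centered_sq_mul_pow_digitSum_three hμ hv, sum_mul]
    refine le_trans (sum_le_sum fun m hm => ?_)
      (sum_le_sum_of_subset_of_nonneg (filter_subset _ _) fun _ _ _ => by positivity)
    rw [mul_comm]
    refine mul_le_mul_of_nonneg_right ?_ (by positivity)
    rw [← sq_abs ((digitSum 3 m : ℝ) - μ * k)]
    have := (mem_filter.1 hm).2
    push Not at this
    exact pow_le_pow_left₀ (by positivity) this.le 2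
  have htail' : ∑ m ∈ (range (3 ^ k)).filter
      (fun m => ¬ |(digitSum 3 m : ℝ) - μ * k| ≤ ε * k), x ^ digitSum 3 m ≤ P ^ k / 2 := by
    refine le_of_mul_le_mul_right (htail.trans ?_) (show (0 : ℝ) < (ε * k) ^ 2 by positivity)
    have h := mul_le_mul_of_nonneg_right hk (show 0 ≤ k * P ^ k by positivity)
    linarith
  have hwin : ∑ m ∈ (range (3 ^ k)).filter
      (fun m => |(digitSum 3 m : ℝ) - μ * k| ≤ ε * k), x ^ digitSum 3 m ≤
      (((range (3 ^ k)).filter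
        (fun m => |(digitSum 3 m : ℝ) - μ * k| ≤ ε * k)).card : ℝ) *
        Real.exp (-(k * (ℓ * (μ - ε)))) := by
    rw [← nsmul_eq_mul]
    refine sum_le_card_nsmul _ _ _ fun m hm => ?_
    have h := (abs_le.1 (mem_filter.1 hm).2).1
    rw [hx, ← Real.exp_nat_mul]
    apply Real.exp_le_exp.2
    nlinarith
  have hexp : Real.exp (k * (Real.log P + ℓ * (μ - ε))) = P ^ k * Real.exp (k * (ℓ * (μ - ε))) := by
    rw [mul_add, Real.exp_add, Real.exp_nat_mul, Real.exp_log hP0]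
  have hcard : P ^ k / 2 ≤ (((range (3 ^ k)).filter
        (fun m => |(digitSum 3 m : ℝ) - μ * k| ≤ ε * k)).card : ℝ) *
        Real.exp (-(k * (ℓ * (μ - ε)))) := by linarith
  rw [Real.exp_neg, ← div_eq_mul_inv, le_div_iff₀ (Real.exp_pos _)] at hcard
  rw [hexp]
  linarith

theorem one_add_div_one_sub_sub_div_add {p q : ℝ} (hq : 0 < q) (hp : 0 < p) :
    (1 + (p - q) / (p + q)) / (1 - (p - q) / (p + q)) = p / q := by
  have hs : p + q ≠ 0 := by positivity
  rw [one_add_div hs, one_sub_div hs, div_div_div_cancel_right₀ hs,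
    show p + q + (p - q) = 2 * p by ring, show p + q - (p - q) = 2 * q by ring,
    mul_div_mul_left _ _ two_ne_zero]

theorem log_div_le_series {p q : ℝ} (hq : 0 < q) (hpq : q ≤ p) (n : ℕ) :
    Real.log (p / q) ≤ 2 * ((∑ i ∈ range n, ((p - q) / (p + q)) ^ (2 * i + 1) / (2 * i + 1)) +
      ((p - q) / (p + q)) ^ (2 * n + 1) / (1 - ((p - q) / (p + q)) ^ 2)) := by
  have hs : 0 < p + q := by linarith
  have h := Real.log_div_le_sum_range_add (x := (p - q) / (p + q))
    (div_nonneg (by linarith) hs.le) (by rw [div_lt_one hs]; linarith) n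
  rw [one_add_div_one_sub_sub_div_add hq (hq.trans_le hpq)] at h
  linarith

theorem series_le_log_div {p q : ℝ} (hq : 0 < q) (hpq : q ≤ p) (n : ℕ) :
    2 * (∑ i ∈ range n, ((p - q) / (p + q)) ^ (2 * i + 1) / (2 * i + 1)) ≤
      Real.log (p / q) := by
  have hs : 0 < p + q := by linarith
  have h := Real.sum_range_le_log_div (x := (p - q) / (p + q))
    (div_nonneg (by linarith) hs.le) (by rw [div_lt_one hs]; linarith) n
  rw [one_add_div_one_sub_sub_div_add hq (hq.trans_le hpq)] at h
  linarith

theorem log_bounds :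
    0.316447506 ≤ Real.log (4855 / 3538) ∧
    0.81526986882 ≤ Real.log (1 + 3538 / 4855 + (3538 / 4855) ^ 2) ∧
    0.409784769 ≤ Real.log (116 / 77) ∧
    Real.log (116 / 77) ≤ 0.40978476926 ∧
    Real.log (193 / 116) ≤ 0.5090999978 := by
  refine ⟨?_, ?_, ?_, ?_, ?_⟩
  · refine le_trans ?_ (series_le_log_div (by norm_num) (by norm_num) 8)
    norm_num [sum_range_succ]
  · rw [show (1 + 3538 / 4855 + (3538 / 4855) ^ 2 : ℝ) =
      (4855 ^ 2 + 4855 * 3538 + 3538 ^ 2) / 4855 ^ 2 by norm_num]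
    refine le_trans ?_ (series_le_log_div (by norm_num) (by norm_num) 15)
    norm_num [sum_range_succ]
  · refine le_trans ?_ (series_le_log_div (by norm_num) (by norm_num) 8)
    norm_num [sum_range_succ]
  · refine (log_div_le_series (by norm_num) (by norm_num) 8).trans ?_
    norm_num [sum_range_succ]
  · refine (log_div_le_series (by norm_num) (by norm_num) 12).trans ?_
    norm_num [sum_range_succ]

theorem exists_two_pow_near_three_pow (k : ℕ) :
    ∃ K : ℕ, 2 * 3 ^ k ≤ 2 ^ K ∧ (K : ℝ) ≤ 1.584962502 * k + 3 := by
  refine ⟨Nat.log 2 (3 ^ k) + 2, ?_, ?_⟩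
  · have := (Nat.lt_pow_succ_log_self one_lt_two (3 ^ k)).le
    rw [pow_succ] at *
    lia
  · have h : 2 ^ Nat.log 2 (3 ^ k) ≤ 3 ^ k := Nat.pow_log_le_self 2 (by positivity)
    have h' : (2 : ℝ) ^ Nat.log 2 (3 ^ k) ≤ 3 ^ k := by exact_mod_cast h
    have hl := Real.log_le_log (by positivity) h'
    rw [Real.log_pow, Real.log_pow] at hl
    have h2 := Real.log_two_gt_d9
    have h3 : Real.log 3 ≤ 1.584962502 * Real.log 2 := by
      have := Real.log_three_lt_d9
      linarith
    have h4 : (Nat.log 2 (3 ^ k) : ℝ) * Real.log 2 ≤ (1.584962502 * k) * Real.log 2 := by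
      nlinarith [mul_le_mul_of_nonneg_left h3 (Nat.cast_nonneg (α := ℝ) k)]
    have h5 := le_of_mul_le_mul_right h4 (by linarith)
    push_cast
    linarith

theorem card_digitSum_two_tail_le_exp {θ L t κ C q : ℝ} {k K : ℕ}
    (hL : Real.log (1 + Real.exp θ) ≤ L) (hL0 : 0 ≤ L) (hK : (K : ℝ) ≤ κ * k + C)
    (hq : κ * L - θ * t ≤ q) :
    (((range (2 ^ K)).filter (fun n => θ * (t * k) ≤ θ * digitSum 2 n)).card : ℝ) ≤
      Real.exp (C * L) * Real.exp (k * q) := by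
  have h := card_digitSum_two_tail_le θ (t * k) K
  rw [← le_div_iff₀ (Real.exp_pos _)] at h
  refine h.trans ?_
  have hpos : 0 < 1 + Real.exp θ := by positivity
  rw [← Real.exp_log hpos, ← Real.exp_nat_mul, ← Real.exp_sub, ← Real.exp_add]
  apply Real.exp_le_exp.2
  have h1 := mul_le_mul_of_nonneg_left hL (Nat.cast_nonneg (α := ℝ) K)
  have h2 := mul_le_mul_of_nonneg_right hK hL0
  have h3 := mul_le_mul_of_nonneg_left hq (Nat.cast_nonneg (α := ℝ) k)
  linarith

theorem eventually_mul_exp_lt {q r : ℝ} (h : q < r) (C : ℝ) :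
    ∀ᶠ k : ℕ in atTop, C * Real.exp (k * q) < Real.exp (k * r) := by
  have ht : Tendsto (fun k : ℕ => Real.exp (k * (r - q))) atTop atTop :=
    Real.tendsto_exp_atTop.comp
      (tendsto_natCast_atTop_atTop.atTop_mul_const (sub_pos.2 h))
  filter_upwards [ht.eventually_gt_atTop C] with k hk
  have := mul_lt_mul_of_pos_right hk (Real.exp_pos (k * q))
  rwa [← Real.exp_add, ← mul_add, sub_add_cancel] at this

/-- Shifting the integers below `3 ^ k` with prescribed ternary sum of digits by `3 ^ k` and removing
those whose binary sum of digits is extreme leaves integers with close sums of digits. -/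
theorem card_window_le_card_close_add_tails {k K N : ℕ} {μ ε β δ : ℝ}
    (hN : 2 * 3 ^ k ≤ N) (hK : 2 * 3 ^ k ≤ 2 ^ K) (hδ : 0 ≤ δ)
    (hβ : β + 2 * ε ≤ δ * Real.log 3) (hk : 1 ≤ ε * k) {θ : ℝ} (hθ : 0 < θ) :
    ((range (3 ^ k)).filter (fun m => |(digitSum 3 m : ℝ) - μ * k| ≤ ε * k)).card ≤
      ((Finset.Icc 1 N).filter (fun n =>
        |(digitSum 3 n : ℝ) - (digitSum 2 n : ℝ)| ≤ δ * Real.log n)).card +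
      (((range (2 ^ K)).filter
        (fun n => (-θ) * ((μ - β) * k) ≤ (-θ) * digitSum 2 n)).card +
      ((range (2 ^ K)).filter
        (fun n => θ * ((μ + β) * k) ≤ θ * digitSum 2 n)).card) := by
  classical
  rw [← card_image_of_injective _ (add_right_injective (3 ^ k))]
  refine le_trans (card_le_card ?_)
    ((card_union_le _ _).trans (add_le_add_right (card_union_le _ _) _))
  intro n hn
  obtain ⟨m, hm, rfl⟩ := mem_image.1 hn
  obtain ⟨hm3, hw⟩ := mem_filter.1 hm
  rw [mem_range] at hm3
  simp only [mem_union, mem_filter, mem_range, Finset.mem_Icc]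
  have hpos : 0 < 3 ^ k := by positivity
  by_cases h1 : (digitSum 2 (3 ^ k + m) : ℝ) ≤ (μ - β) * k
  · exact Or.inr (Or.inl ⟨by lia, by nlinarith⟩)
  by_cases h2 : (μ + β) * k ≤ (digitSum 2 (3 ^ k + m) : ℝ)
  · exact Or.inr (Or.inr ⟨by lia, by nlinarith⟩)
  push Not at h1 h2
  refine Or.inl ⟨⟨by lia, by lia⟩, ?_⟩
  have hlog : k * Real.log 3 ≤ Real.log ((3 ^ k + m : ℕ) : ℝ) := by
    rw [← Real.log_pow]
    apply Real.log_le_log (by positivity)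
    push_cast
    linarith [Nat.cast_nonneg (α := ℝ) m]
  have hlog' := mul_le_mul_of_nonneg_left hlog hδ
  have hβk := mul_le_mul_of_nonneg_right hβ (Nat.cast_nonneg (α := ℝ) k)
  rw [digitSum_pow_add (by norm_num) k m hm3]
  obtain ⟨hw1, hw2⟩ := abs_le.1 hw
  push_cast at *
  rw [abs_le]
  constructor <;> linarith

/-- For all sufficiently large `N`, the number of positive integers `n ≤ N` with
`|s₃(n) - s₂(n)| ≤ 0.1457205 · log n` is greater than `N ^ 0.970359`. -/
theorem sums_digits_close_card_lower_bound :
    ∀ᶠ N : ℕ in atTop,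
      ((N : ℝ) ^ (0.970359 : ℝ) <
        (((Finset.Icc 1 N).filter (fun n =>
          |(digitSum 3 n : ℝ) - (digitSum 2 n : ℝ)| ≤ 0.1457205 * Real.log n)).card : ℝ)) := by
  obtain ⟨hA, hB, hC0, hC, hD⟩ := log_bounds
  have h2 := Real.log_two_gt_d9
  have h3 := Real.log_three_gt_d9
  have h3' := Real.log_three_lt_d9
  have hexpA : Real.exp (-Real.log (4855 / 3538)) = 3538 / 4855 := by
    rw [Real.exp_neg, Real.exp_log (by norm_num)]
    norm_num
  have hexpC : Real.exp (-Real.log (116 / 77)) = 77 / 116 := by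
    rw [Real.exp_neg, Real.exp_log (by norm_num)]
    norm_num
  have hexpC' : Real.exp (Real.log (116 / 77)) = 116 / 77 := Real.exp_log (by norm_num)
  have hCpos : 0 < Real.log (116 / 77) := Real.log_pos (by norm_num)
  have hsum : Real.log (1 + 116 / 77) ≤ 0.91888476706 := by
    rw [show (1 + 116 / 77 : ℝ) = (193 / 116) * (116 / 77) by norm_num,
      Real.log_mul (by norm_num) (by norm_num)]
    linarith
  obtain ⟨μ, hμ⟩ : ∃ μ : ℝ, μ = (3538 / 4855 + 2 * (3538 / 4855) ^ 2) /
    (1 + 3538 / 4855 + (3538 / 4855) ^ 2) := ⟨_, rfl⟩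
  have hμ1 : 0.7924812588 ≤ μ := by rw [hμ]; norm_num
  have hμ2 : μ ≤ 0.7924812589 := by rw [hμ]; norm_num
  obtain ⟨v, hv⟩ : ∃ v : ℝ, v = (μ ^ 2 + (1 - μ) ^ 2 * (3538 / 4855) +
    (2 - μ) ^ 2 * (3538 / 4855) ^ 2) / (1 + 3538 / 4855 + (3538 / 4855) ^ 2) := ⟨_, rfl⟩
  have hF : 1.0660485815 < Real.log (1 + 3538 / 4855 + (3538 / 4855) ^ 2) +
      Real.log (4855 / 3538) * (μ - 1 / 10 ^ 9) := by
    nlinarith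
  obtain ⟨F, hFdef⟩ : ∃ F : ℝ, F = Real.log (1 + 3538 / 4855 + (3538 / 4855) ^ 2) +
      Real.log (4855 / 3538) * (μ - 1 / 10 ^ 9) := ⟨_, rfl⟩
  rw [← hFdef] at hF
  have hlarge : ∀ᶠ k : ℕ in atTop, 2 * v ≤ (1 / 10 ^ 9 : ℝ) ^ 2 * k ∧
      1 ≤ (1 / 10 ^ 9 : ℝ) * k ∧ 0 < k ∧
      (2 * (Real.exp (2 * (0.970359 * Real.log 3)) + Real.exp (3 * 0.5090999978) +
        Real.exp (3 * 0.91888476706))) * Real.exp (k * 1.0660485815) < Real.exp (k * F) := by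
    refine ((Tendsto.const_mul_atTop (by positivity)
      tendsto_natCast_atTop_atTop).eventually_ge_atTop _).and
      (((Tendsto.const_mul_atTop (by positivity)
      tendsto_natCast_atTop_atTop).eventually_ge_atTop _).and
      ((eventually_gt_atTop 0).and (eventually_mul_exp_lt hF _)))
  have hk : Tendsto (fun N : ℕ => Nat.log 3 N - 1) atTop atTop :=
    (tendsto_sub_atTop_nat 1).comp (tendsto_atTop_atTop_of_monotone Nat.log_monotone
      fun n => ⟨3 ^ n, (Nat.log_pow (by norm_num) n).ge⟩)
  filter_upwards [hk.eventually hlarge, eventually_ge_atTop 3] with N hN hN3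
  obtain ⟨k, hkN⟩ : ∃ k, Nat.log 3 N = k + 1 :=
    ⟨Nat.log 3 N - 1, (Nat.sub_add_cancel (Nat.log_pos (by norm_num) hN3)).symm⟩
  rw [hkN, Nat.add_sub_cancel] at hN
  obtain ⟨hvk, hεk, hk0, hexp⟩ := hN
  have hlow : 3 ^ (k + 1) ≤ N := hkN ▸ Nat.pow_log_le_self 3 (by lia)
  have hup : N < 3 ^ (k + 2) := by
    have := Nat.lt_pow_succ_log_self (b := 3) (by norm_num) N
    rwa [hkN] at this
  obtain ⟨K, hK, hKle⟩ := exists_two_pow_near_three_pow k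
  have hwindow := card_digitSum_three_window_ge (ℓ := Real.log (4855 / 3538)) (μ := μ) (v := v)
    (ε := 1 / 10 ^ 9) (Real.log_pos (by norm_num)) (by positivity)
    (by rw [hexpA, hμ]; norm_num)
    (by rw [hexpA, hv, div_mul_cancel₀ _ (by norm_num)]) hvk hk0
  rw [hexpA, ← hFdef] at hwindow
  have hcount := card_window_le_card_close_add_tails (N := N) (μ := μ) (ε := 1 / 10 ^ 9)
    (β := 0.1600903299) (δ := 0.1457205) (by rw [pow_succ] at hlow; lia) hK (by norm_num)
    (by linarith) hεk hCpos
  have hlowtail := card_digitSum_two_tail_le_exp (θ := -Real.log (116 / 77))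
    (t := μ - 0.1600903299) (q := 1.0660485815) (k := k) (L := 0.5090999978)
    (by rw [hexpC]; norm_num at hD ⊢; exact hD) (by norm_num) hKle (by nlinarith)
  have huptail := card_digitSum_two_tail_le_exp (θ := Real.log (116 / 77))
    (t := μ + 0.1600903299) (q := 1.0660485815) (k := k) (L := 0.91888476706)
    (by rw [hexpC']; exact hsum) (by norm_num) hKle (by nlinarith)
  have hpow : (N : ℝ) ^ (0.970359 : ℝ) ≤
      Real.exp (2 * (0.970359 * Real.log 3)) * Real.exp (k * 1.0660485815) := by
    have hN' : (N : ℝ) ≤ 3 ^ (k + 2) := by exact_mod_cast hup.le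
    have hNpos : (0 : ℝ) < N := by exact_mod_cast (by lia : 0 < N)
    have hlogN := Real.log_le_log hNpos hN'
    rw [Real.log_pow] at hlogN
    push_cast at hlogN
    rw [Real.rpow_def_of_pos hNpos, ← Real.exp_add]
    apply Real.exp_le_exp.2
    have : (k : ℝ) * (0.970359 * Real.log 3) ≤ k * 1.0660485815 :=
      mul_le_mul_of_nonneg_left (by linarith) (Nat.cast_nonneg _)
    linarith
  have hcount' := (Nat.cast_le (α := ℝ)).2 hcount
  push_cast at hcount'
  linarith
end

section
/- Fix an integer b ≥ 2 and a real number y > 0. Then as x → ∞, (1/x) · Card{ n < x : |s_b(n) − (b−1)·log n/(2·log b)| < y · ((b²−1)·log n/(12·log b))^{1/2} } converges to (1/√(2π)) · ∫_{−y}^{y} e^{−t²/2} dt. -/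
open Filter Finset Real

section DigitSum

lemma digitSum_mul_add {b : ℕ} (hb : 2 ≤ b) {d : ℕ} (hd : d < b) (q : ℕ) :
    digitSum b (b * q + d) = digitSum b q + d := by
  unfold digitSum
  by_cases h : d = 0 ∧ q = 0
  · simp [h.1, h.2]
  · rw [add_comm (b * q), Nat.digits_add b (by omega) d q hd (by tauto)]
    simp [add_comm]

lemma digitSum_pow_mul_add {b : ℕ} (hb : 2 ≤ b) (m q : ℕ) {u : ℕ} (hu : u < b ^ m) :
    digitSum b (b ^ m * q + u) = digitSum b q + digitSum b u := by
  induction m generalizing u with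
  | zero =>
    obtain rfl : u = 0 := by simpa using hu
    simp [digitSum]
  | succ m ih =>
    have hmod : u % b < b := Nat.mod_lt _ (by omega)
    have hdiv : u / b < b ^ m := Nat.div_lt_of_lt_mul (by rwa [← pow_succ'])
    have h1 : b ^ (m + 1) * q + u = b * (b ^ m * q + u / b) + u % b := by
      conv_lhs => rw [← Nat.div_add_mod u b]
      ring
    have h2 : digitSum b u = digitSum b (u / b) + u % b := by
      conv_lhs => rw [← Nat.div_add_mod u b]
      exact digitSum_mul_add hb hmod _
    rw [h1, digitSum_mul_add hb hmod, ih hdiv, h2, add_assoc]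

lemma sum_range_mul_eq_sum_sum {M : Type*} [AddCommMonoid M] (f : ℕ → M) (a b : ℕ) :
    ∑ n ∈ range (b * a), f n = ∑ q ∈ range a, ∑ d ∈ range b, f (b * q + d) := by
  induction a with
  | zero => simp
  | succ a ih => rw [mul_add, mul_one, sum_range_add, ih, sum_range_succ]

lemma sum_cexp_digitSum {b : ℕ} (hb : 2 ≤ b) (z c : ℂ) (m : ℕ) :
    ∑ u ∈ range (b ^ m), Complex.exp (z * (digitSum b u - m * c)) =
      (∑ d ∈ range b, Complex.exp (z * (d - c))) ^ m := by
  induction m with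
  | zero => simp [digitSum]
  | succ m ih =>
    rw [pow_succ', sum_range_mul_eq_sum_sum, pow_succ, ← ih, sum_mul]
    refine sum_congr rfl fun q _ ↦ ?_
    rw [mul_sum]
    refine sum_congr rfl fun d hd ↦ ?_
    rw [digitSum_mul_add hb (mem_range.1 hd), ← Complex.exp_add]
    push_cast
    ring_nf

lemma sum_range_sub_half (n : ℕ) : ∑ d ∈ range n, ((d : ℝ) - ((n : ℝ) - 1) / 2) = 0 := by
  have h : ∑ d ∈ range n, (d : ℝ) = n * (n - 1) / 2 := by
    induction n with
    | zero => simp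
    | succ n ih => rw [sum_range_succ, ih]; push_cast; ring
  rw [sum_sub_distrib, h]
  simp
  ring

lemma sum_range_sub_half_sq (n : ℕ) :
    ∑ d ∈ range n, ((d : ℝ) - ((n : ℝ) - 1) / 2) ^ 2 = n * (((n : ℝ) ^ 2 - 1) / 12) := by
  have h (c : ℝ) : ∑ d ∈ range n, ((d : ℝ) - c) ^ 2 =
      n * (n - 1) * (2 * n - 1) / 6 - c * (n * (n - 1)) + n * c ^ 2 := by
    induction n with
    | zero => simp
    | succ n ih => rw [sum_range_succ, ih]; push_cast; ring
  rw [h]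
  ring

end DigitSum

section Empirical

open MeasureTheory ProbabilityTheory

/-- The law of `f` at a uniformly random element of `range n`. -/
noncomputable def empiricalMeasure (n : ℕ) (f : ℕ → ℝ) : Measure ℝ :=
  (n : ENNReal)⁻¹ • ∑ i ∈ range n, Measure.dirac (f i)

lemma isProbabilityMeasure_empiricalMeasure {n : ℕ} (hn : n ≠ 0) (f : ℕ → ℝ) :
    IsProbabilityMeasure (empiricalMeasure n f) := by
  constructor
  simp [empiricalMeasure, ENNReal.inv_mul_cancel, hn]

lemma integral_empiricalMeasure {E : Type*} [NormedAddCommGroup E] [NormedSpace ℝ E]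
    [CompleteSpace E] (n : ℕ) (f : ℕ → ℝ) (g : ℝ → E) :
    ∫ x, g x ∂(empiricalMeasure n f) = (n : ℝ)⁻¹ • ∑ i ∈ range n, g (f i) := by
  rw [empiricalMeasure, integral_smul_measure, integral_finsetSum_measure]
  · simp
  · intro i _
    exact integrable_dirac (by simp)

lemma empiricalMeasure_real_apply (n : ℕ) (f : ℕ → ℝ) {s : Set ℝ} (hs : MeasurableSet s)
    [DecidablePred (· ∈ s)] :
    (empiricalMeasure n f).real s = ((range n).filter (fun i ↦ f i ∈ s)).card / (n : ℝ) := by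
  rw [← integral_indicator_one hs, integral_empiricalMeasure, div_eq_inv_mul, smul_eq_mul]
  simp [Set.indicator_apply]

/-- The centred and normalised sum of `m` base-`b` digits. -/
noncomputable def normalizedDigitSum (b m u : ℕ) : ℝ :=
  (√(m : ℝ))⁻¹ * (((digitSum b u : ℝ) - m * (((b : ℝ) - 1) / 2)) / √(((b : ℝ) ^ 2 - 1) / 12))

lemma charFun_empiricalMeasure_normalizedDigitSum {b : ℕ} (hb : 2 ≤ b) (m : ℕ) (t : ℝ) :
    charFun (empiricalMeasure (b ^ m) (normalizedDigitSum b m)) t =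
      charFun (empiricalMeasure b
        (fun d ↦ ((d : ℝ) - ((b : ℝ) - 1) / 2) / √(((b : ℝ) ^ 2 - 1) / 12)))
          ((√(m : ℝ))⁻¹ * t) ^ m := by
  rw [charFun_apply_real, charFun_apply_real, integral_empiricalMeasure, integral_empiricalMeasure]
  have h := sum_cexp_digitSum hb
    ((√(m : ℝ))⁻¹ * t / √(((b : ℝ) ^ 2 - 1) / 12) * Complex.I) (((b : ℝ) - 1) / 2) m
  rw [smul_pow, Nat.cast_pow, ← inv_pow]
  congr 1
  convert! h using 3
  · rw [normalizedDigitSum]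
    push_cast
    ring_nf
  · push_cast
    ring_nf

lemma tendsto_empiricalMeasure_normalizedDigitSum {b : ℕ} (hb : 2 ≤ b) :
    Tendsto (β := ProbabilityMeasure ℝ)
      (fun m ↦ ⟨empiricalMeasure (b ^ m) (normalizedDigitSum b m),
        isProbabilityMeasure_empiricalMeasure (by positivity) _⟩) atTop
      (nhds ⟨gaussianReal 0 1, inferInstance⟩) := by
  refine ProbabilityMeasure.tendsto_iff_tendsto_charFun.2 fun t ↦ ?_
  have hb0 : b ≠ 0 := by omega
  have hb' : (2 : ℝ) ≤ b := by exact_mod_cast hb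
  have hσ : 0 < ((b : ℝ) ^ 2 - 1) / 12 := by nlinarith
  simp only [ProbabilityMeasure.coe_mk, charFun_empiricalMeasure_normalizedDigitSum hb]
  have := isProbabilityMeasure_empiricalMeasure hb0
    (fun d ↦ ((d : ℝ) - ((b : ℝ) - 1) / 2) / √(((b : ℝ) ^ 2 - 1) / 12))
  have key := tendsto_charFun_inv_sqrt_mul_pow (X := id) (P := empiricalMeasure b
    (fun d ↦ ((d : ℝ) - ((b : ℝ) - 1) / 2) / √(((b : ℝ) ^ 2 - 1) / 12)))
    aemeasurable_id ?_ ?_ t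
  · rw [Measure.map_id] at key
    simpa [charFun_gaussianReal, neg_div] using key
  · simp only [id, integral_empiricalMeasure, ← sum_div, sum_range_sub_half]
    simp
  · simp only [id, Pi.pow_apply, integral_empiricalMeasure, div_pow, ← sum_div,
      sum_range_sub_half_sq, Real.sq_sqrt hσ.le, smul_eq_mul]
    rw [mul_div_cancel_right₀ _ hσ.ne', inv_mul_cancel₀ (by positivity)]

lemma gaussianReal_real_Ioo {z : ℝ} (hz : 0 ≤ z) :
    (gaussianReal 0 1).real (Set.Ioo (-z) z) =
      (1 / √(2 * π)) * ∫ t in (-z)..z, Real.exp (-t ^ 2 / 2) := by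
  rw [measureReal_def, gaussianReal_apply_eq_integral _ one_ne_zero, ENNReal.toReal_ofReal
    (integral_nonneg fun x ↦ gaussianPDFReal_nonneg _ _ x),
    intervalIntegral.integral_of_le (by linarith), integral_Ioc_eq_integral_Ioo,
    ← integral_const_mul]
  simp [gaussianPDFReal]

/-- The proportion of `u < b ^ m` whose digit sum is within `z` standard deviations of the mean. -/
noncomputable def centralProportion (b m : ℕ) (z : ℝ) : ℝ :=
  (((range (b ^ m)).filter (fun u : ℕ ↦
    |(digitSum b u : ℝ) - ((b : ℝ) - 1) / 2 * m| < z * √(((b : ℝ) ^ 2 - 1) / 12 * m))).card : ℝ) /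
      (b : ℝ) ^ m

lemma tendsto_centralProportion {b : ℕ} (hb : 2 ≤ b) {z : ℝ} (hz : 0 ≤ z) :
    Tendsto (fun m ↦ centralProportion b m z) atTop
      (nhds ((1 / √(2 * π)) * ∫ t in (-z)..z, Real.exp (-t ^ 2 / 2))) := by
  have hb' : (2 : ℝ) ≤ b := by exact_mod_cast hb
  have hσ : 0 < ((b : ℝ) ^ 2 - 1) / 12 := by nlinarith
  have := nullSingletonClass_gaussianReal (μ := 0) (v := 1) one_ne_zero
  have h := ProbabilityMeasure.tendsto_measure_of_null_frontier_of_tendsto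
    (tendsto_empiricalMeasure_normalizedDigitSum hb) (E := Set.Ioo (-z) z) (by
      have : gaussianReal 0 1 (frontier (Set.Ioo (-z) z)) = 0 := by
        refine measure_mono_null ?_ (Set.Finite.measure_zero (Set.toFinite {-z, z}) _)
        rcases hz.eq_or_lt with rfl | hz
        · simp
        · rw [frontier_Ioo (by linarith)]
      exact congrArg ENNReal.toNNReal this)
  rw [← gaussianReal_real_Ioo hz]
  have h' := (NNReal.tendsto_coe.2 h)
  refine h'.congr' ?_
  filter_upwards [eventually_ge_atTop 1] with m hm
  have hm' : (0 : ℝ) < m := by exact_mod_cast hm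
  have hmem (u : ℕ) : normalizedDigitSum b m u ∈ Set.Ioo (-z) z ↔
      |(digitSum b u : ℝ) - ((b : ℝ) - 1) / 2 * m| < z * √(((b : ℝ) ^ 2 - 1) / 12 * m) := by
    have h1 : normalizedDigitSum b m u = ((digitSum b u : ℝ) - ((b : ℝ) - 1) / 2 * m) /
        √(((b : ℝ) ^ 2 - 1) / 12 * m) := by
      rw [normalizedDigitSum, Real.sqrt_mul hσ.le]
      field_simp
    rw [Set.mem_Ioo, ← abs_lt, h1, abs_div, abs_of_nonneg (Real.sqrt_nonneg _),
      div_lt_iff₀ (by positivity)]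
  classical
  refine (empiricalMeasure_real_apply _ _ measurableSet_Ioo).trans ?_
  rw [centralProportion, Nat.cast_pow]
  simp only [hmem]

lemma continuous_intervalIntegral_neg_self :
    Continuous fun z : ℝ ↦ (1 / √(2 * π)) * ∫ t in (-z)..z, Real.exp (-t ^ 2 / 2) := by
  have hc : Continuous fun t : ℝ ↦ Real.exp (-t ^ 2 / 2) := by fun_prop
  have hi (a c : ℝ) : IntervalIntegrable (fun t : ℝ ↦ Real.exp (-t ^ 2 / 2)) volume a c :=
    hc.intervalIntegrable _ _
  have h := intervalIntegral.continuous_primitive hi 0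
  have h2 : (fun z : ℝ ↦ ∫ t in (-z)..z, Real.exp (-t ^ 2 / 2)) = fun z ↦
      (∫ t in (0 : ℝ)..z, Real.exp (-t ^ 2 / 2)) - ∫ t in (0 : ℝ)..(-z), Real.exp (-t ^ 2 / 2) := by
    ext z
    rw [intervalIntegral.integral_interval_sub_left (hi _ _) (hi _ _)]
  exact continuous_const.mul (h2 ▸ h.sub (h.comp continuous_neg))

end Empirical
section Counting

/-- `DigitSumWithin b y n` says that the digit sum of `n` lies within `y` heuristic standard
deviations of its heuristic mean. -/
def DigitSumWithin (b : ℕ) (y : ℝ) (n : ℕ) : Prop :=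
  |(digitSum b n : ℝ) - ((b : ℝ) - 1) * Real.log (n : ℝ) / (2 * Real.log (b : ℝ))| <
    y * (((b : ℝ) ^ 2 - 1) * Real.log (n : ℝ) / (12 * Real.log (b : ℝ))) ^ ((1 : ℝ) / 2)

noncomputable instance (b : ℕ) (y : ℝ) : DecidablePred (DigitSumWithin b y) :=
  fun _ ↦ inferInstanceAs (Decidable (_ < _))

lemma abs_lt_transfer {A B C D y δ s t : ℝ} (hy : 0 < y) (hAB : |A - B| ≤ C) (hst : s ≤ t)
    (hts : t ≤ s + D) (hδ : y * D + C ≤ δ * s) (hD : 0 ≤ D) :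
    (|A| < y * t → |B| < (y + δ) * s) ∧ (|B| < (y - δ) * s → |A| < y * t) := by
  have h1 := abs_sub_abs_le_abs_sub A B
  have h2 := abs_sub_abs_le_abs_sub B A
  rw [abs_sub_comm B A] at h2
  have h3 := mul_le_mul_of_nonneg_left hst hy.le
  have h4 := mul_le_mul_of_nonneg_left hts hy.le
  have h5 := mul_nonneg hy.le hD
  constructor <;> intro h <;> nlinarith

lemma digitSumWithin_transfer {b : ℕ} (hb : 2 ≤ b) {y δ : ℝ} (hy : 0 < y) {m r q u : ℕ}
    (hu : u < b ^ m) (hq0 : q ≠ 0) (hq : q < b ^ (r + 1))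
    (hδ : y * √(((b : ℝ) ^ 2 - 1) / 12 * (r + 1)) +
      ((b : ℝ) ^ (r + 1) + ((b : ℝ) - 1) / 2 * (r + 1)) ≤ δ * √(((b : ℝ) ^ 2 - 1) / 12 * m)) :
    (DigitSumWithin b y (b ^ m * q + u) →
      |(digitSum b u : ℝ) - ((b : ℝ) - 1) / 2 * m| < (y + δ) * √(((b : ℝ) ^ 2 - 1) / 12 * m)) ∧
    (|(digitSum b u : ℝ) - ((b : ℝ) - 1) / 2 * m| < (y - δ) * √(((b : ℝ) ^ 2 - 1) / 12 * m) →
      DigitSumWithin b y (b ^ m * q + u)) := by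
  have hb' : (2 : ℝ) ≤ b := by exact_mod_cast hb
  have hv : 0 < ((b : ℝ) ^ 2 - 1) / 12 := by nlinarith
  have hlog : 0 < Real.log b := Real.log_pos (by linarith)
  have hpow : 0 < b ^ m := by positivity
  set n := b ^ m * q + u with hn
  set L := Real.log n / Real.log b with hL
  have hn1 : b ^ m ≤ n := (Nat.le_mul_of_pos_right _ (by omega)).trans (Nat.le_add_right _ _)
  have hn2 : n ≤ b ^ (m + (r + 1)) := by
    rw [pow_add]
    nlinarith [Nat.mul_le_mul_left (b ^ m) (Nat.succ_le_of_lt hq)]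
  have hnpos : (0 : ℝ) < n := by exact_mod_cast hpow.trans_le hn1
  have hL1 : (m : ℝ) ≤ L := by
    rw [hL, le_div_iff₀ hlog, ← Real.log_pow]
    exact Real.log_le_log (by positivity) (by exact_mod_cast hn1)
  have hL2 : L ≤ m + (r + 1) := by
    rw [hL, div_le_iff₀ hlog]
    have := Real.log_le_log hnpos (y := (b : ℝ) ^ (m + (r + 1))) (by exact_mod_cast hn2)
    rw [Real.log_pow] at this
    exact_mod_cast this
  have e1 : ((b : ℝ) - 1) * Real.log n / (2 * Real.log b) = ((b : ℝ) - 1) / 2 * L := by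
    rw [hL]; field_simp
  have e2 : ((b : ℝ) ^ 2 - 1) * Real.log n / (12 * Real.log b) = ((b : ℝ) ^ 2 - 1) / 12 * L := by
    rw [hL]; field_simp
  rw [DigitSumWithin, e1, e2, ← Real.sqrt_eq_rpow]
  have hs : digitSum b n = digitSum b q + digitSum b u := digitSum_pow_mul_add hb m q hu
  have hsq : (digitSum b q : ℝ) ≤ (b : ℝ) ^ (r + 1) := by
    exact_mod_cast (Nat.digit_sum_le b q).trans hq.le
  have hsq0 : (0 : ℝ) ≤ digitSum b q := Nat.cast_nonneg _
  refine abs_lt_transfer hy ?_ (Real.sqrt_le_sqrt ?_) ?_ hδ (Real.sqrt_nonneg _)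
  · rw [hs, abs_le]
    push_cast
    have h1 : 0 ≤ ((b : ℝ) - 1) / 2 * (L - m) := mul_nonneg (by linarith) (by linarith)
    have h2 : ((b : ℝ) - 1) / 2 * (L - m) ≤ ((b : ℝ) - 1) / 2 * (r + 1) :=
      mul_le_mul_of_nonneg_left (by linarith) (by linarith)
    have h3 : 0 ≤ ((b : ℝ) - 1) / 2 * (r + 1) := h1.trans h2
    constructor <;> nlinarith
  · exact mul_le_mul_of_nonneg_left hL1 hv.le
  · refine (Real.sqrt_le_sqrt (mul_le_mul_of_nonneg_left hL2 hv.le)).trans ?_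
    rw [mul_add, Real.sqrt_le_iff, add_sq, Real.sq_sqrt (by positivity),
      Real.sq_sqrt (by positivity)]
    refine ⟨by positivity, ?_⟩
    have : 0 ≤ 2 * √(((b : ℝ) ^ 2 - 1) / 12 * m) * √(((b : ℝ) ^ 2 - 1) / 12 * (r + 1)) := by
      positivity
    linarith

lemma card_filter_range_mul_eq_sum (P : ℕ → Prop) [DecidablePred P] (M Q : ℕ) :
    ((range (M * Q)).filter P).card =
      ∑ q ∈ range Q, ((range M).filter fun u ↦ P (M * q + u)).card := by
  simp only [card_filter]
  exact sum_range_mul_eq_sum_sum _ _ _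

lemma card_filter_range_le {P R : ℕ → Prop} [DecidablePred P] [DecidablePred R] {M Q x : ℕ}
    (hx : x ≤ M * (Q + 1)) (h : ∀ q ≤ Q, q ≠ 0 → ∀ u < M, P (M * q + u) → R u) :
    ((range x).filter P).card ≤ Q * ((range M).filter R).card + M := by
  calc ((range x).filter P).card ≤ ((range (M * (Q + 1))).filter P).card := by gcongr
    _ ≤ ∑ _q ∈ range Q, ((range M).filter R).card + M := by
      rw [card_filter_range_mul_eq_sum, sum_range_succ']
      refine add_le_add (sum_le_sum fun q hq ↦ card_le_card fun u hu ↦ ?_)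
        ((card_filter_le _ _).trans (card_range M).le)
      rw [mem_filter, mem_range] at hu ⊢
      exact ⟨hu.1, h _ (mem_range.1 hq) q.succ_ne_zero _ hu.1 hu.2⟩
    _ = _ := by simp

lemma le_card_filter_range {P R : ℕ → Prop} [DecidablePred P] [DecidablePred R] {M Q x : ℕ}
    (hx : M * Q ≤ x) (h : ∀ q ≤ Q, q ≠ 0 → ∀ u < M, R u → P (M * q + u)) :
    Q * ((range M).filter R).card ≤ ((range x).filter P).card + M := by
  have hR : ((range M).filter R).card ≤ M := (card_filter_le _ _).trans (card_range M).le
  rcases Q with _ | Q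
  · simp
  · calc (Q + 1) * ((range M).filter R).card ≤ Q * ((range M).filter R).card + M := by
          rw [add_mul, one_mul]; gcongr
      _ = ∑ _q ∈ range Q, ((range M).filter R).card + M := by simp
      _ ≤ ((range (M * (Q + 1))).filter P).card + M := by
        rw [card_filter_range_mul_eq_sum, sum_range_succ']
        refine Nat.add_le_add_right (le_add_right (sum_le_sum fun q hq ↦
          card_le_card fun u hu ↦ ?_)) M
        rw [mem_filter, mem_range] at hu ⊢
        exact ⟨hu.1, h _ (Nat.succ_le_succ (mem_range.1 hq).le) q.succ_ne_zero _ hu.1 hu.2⟩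
      _ ≤ _ := by gcongr

lemma tendsto_log_sub_atTop {b : ℕ} (hb : 2 ≤ b) (r : ℕ) :
    Tendsto (fun x ↦ Nat.log b x - r) atTop atTop :=
  (tendsto_sub_atTop_nat r).comp <| tendsto_atTop.2 fun k ↦ by
    filter_upwards [eventually_ge_atTop (b ^ k)] with x hx
    exact Nat.le_log_of_pow_le hb hx

lemma eventually_digitSumWithin_proportion {b : ℕ} (hb : 2 ≤ b) {y δ : ℝ} (hy : 0 < y)
    (hδ : 0 < δ) (r : ℕ) :
    ∀ᶠ x : ℕ in atTop,
      (((range x).filter (DigitSumWithin b y)).card : ℝ) / x ≤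
        centralProportion b (Nat.log b x - r) (y + δ) + 1 / (b : ℝ) ^ r ∧
      centralProportion b (Nat.log b x - r) (y - δ) - 2 / (b : ℝ) ^ r ≤
        (((range x).filter (DigitSumWithin b y)).card : ℝ) / x := by
  have hb' : (2 : ℝ) ≤ b := by exact_mod_cast hb
  have hv : 0 < ((b : ℝ) ^ 2 - 1) / 12 := by nlinarith
  have hm := tendsto_log_sub_atTop hb r
  have hsqrt : Tendsto (fun x ↦ δ * √(((b : ℝ) ^ 2 - 1) / 12 * (Nat.log b x - r : ℕ)))
      atTop atTop :=
    ((Real.tendsto_sqrt_atTop.comp ((tendsto_natCast_atTop_atTop.comp hm).const_mul_atTop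
      hv)).const_mul_atTop hδ)
  filter_upwards [hsqrt.eventually_ge_atTop _, eventually_ge_atTop (b ^ r)] with x hx hxr
  have hbr : 0 < b ^ r := by positivity
  have hx0 : x ≠ 0 := by omega
  have hr : r ≤ Nat.log b x := Nat.le_log_of_pow_le hb hxr
  set m := Nat.log b x - r with hmdef
  have hM : 0 < b ^ m := by positivity
  set Q := x / b ^ m with hQdef
  have hQ1 : b ^ r ≤ Q := by
    rw [hQdef, Nat.le_div_iff_mul_le hM, ← pow_add, hmdef, Nat.add_sub_cancel' hr]
    exact Nat.pow_log_le_self b hx0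
  have hQ2 : Q < b ^ (r + 1) := by
    rw [hQdef, Nat.div_lt_iff_lt_mul hM, ← pow_add, hmdef,
      show r + 1 + (Nat.log b x - r) = Nat.log b x + 1 by omega]
    exact Nat.lt_pow_succ_log_self hb x
  have hxlow : b ^ m * Q ≤ x := Nat.mul_div_le x (b ^ m)
  have hxup : x ≤ b ^ m * (Q + 1) := (Nat.lt_mul_div_succ x hM).le
  have hup := card_filter_range_le (P := DigitSumWithin b y) hxup fun q hqQ hq0 u hu ↦
    (digitSumWithin_transfer hb hy hu hq0 (hqQ.trans_lt hQ2) hx).1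
  have hlow := le_card_filter_range (P := DigitSumWithin b y) hxlow fun q hqQ hq0 u hu ↦
    (digitSumWithin_transfer hb hy hu hq0 (hqQ.trans_lt hQ2) hx).2
  have hxpos : (0 : ℝ) < x := by positivity
  have hMR : (0 : ℝ) < (b : ℝ) ^ m := by positivity
  have hBR : (0 : ℝ) < (b : ℝ) ^ r := by positivity
  have hQR : (b : ℝ) ^ r ≤ Q := by exact_mod_cast hQ1
  have hxlowR : (b : ℝ) ^ m * Q ≤ x := by exact_mod_cast hxlow
  have hxupR : (x : ℝ) ≤ (b : ℝ) ^ m * (Q + 1) := by exact_mod_cast hxup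
  have hMx : (b : ℝ) ^ m * (b : ℝ) ^ r ≤ x :=
    (mul_le_mul_of_nonneg_left hQR hMR.le).trans hxlowR
  unfold centralProportion
  set c₁ := ((range (b ^ m)).filter fun u : ℕ ↦ |(digitSum b u : ℝ) - ((b : ℝ) - 1) / 2 * m| <
    (y + δ) * √(((b : ℝ) ^ 2 - 1) / 12 * m)).card
  set c₂ := ((range (b ^ m)).filter fun u : ℕ ↦ |(digitSum b u : ℝ) - ((b : ℝ) - 1) / 2 * m| <
    (y - δ) * √(((b : ℝ) ^ 2 - 1) / 12 * m)).card with hc₂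
  have hc₂M : (c₂ : ℝ) ≤ (b : ℝ) ^ m := by
    exact_mod_cast (card_filter_le _ _).trans (card_range (b ^ m)).le
  have hupR : (((range x).filter (DigitSumWithin b y)).card : ℝ) ≤ Q * c₁ + (b : ℝ) ^ m := by
    exact_mod_cast hup
  have hlowR : (Q : ℝ) * c₂ ≤ ((range x).filter (DigitSumWithin b y)).card + (b : ℝ) ^ m := by
    exact_mod_cast hlow
  have hfrac : (b : ℝ) ^ m ≤ 1 / (b : ℝ) ^ r * x := by
    rw [one_div_mul_eq_div, le_div_iff₀ hBR]
    exact hMx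
  constructor
  · rw [div_le_iff₀ hxpos, add_mul]
    have h1 : (Q : ℝ) * c₁ ≤ c₁ / (b : ℝ) ^ m * x := by
      calc (Q : ℝ) * c₁ = c₁ / (b : ℝ) ^ m * ((b : ℝ) ^ m * Q) := by field_simp
        _ ≤ _ := by gcongr
    linarith
  · rw [le_div_iff₀ hxpos, sub_mul]
    have h1 : c₂ / (b : ℝ) ^ m * x ≤ Q * c₂ + c₂ := by
      calc c₂ / (b : ℝ) ^ m * x ≤ c₂ / (b : ℝ) ^ m * ((b : ℝ) ^ m * (Q + 1)) := by gcongr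
        _ = _ := by field_simp
    have h2 : 2 / (b : ℝ) ^ r * x = 2 * (1 / (b : ℝ) ^ r * x) := by ring
    linarith

end Counting

/-- Central limit theorem for the digit sum function `s_b` (Bassily–Kátai). -/
theorem digit_sum_central_limit (b : ℕ) (hb : 2 ≤ b) (y : ℝ) (hy : 0 < y) :
    Tendsto (fun x : ℕ =>
      (((Finset.range x).filter (fun n : ℕ =>
          |(digitSum b n : ℝ) - ((b : ℝ) - 1) * Real.log (n : ℝ) / (2 * Real.log (b : ℝ))| <
            y * (((b : ℝ) ^ 2 - 1) * Real.log (n : ℝ) / (12 * Real.log (b : ℝ)))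
              ^ ((1 : ℝ) / 2))).card : ℝ) / (x : ℝ))
      atTop
      (nhds ((1 / Real.sqrt (2 * Real.pi)) * ∫ t in (-y)..y, Real.exp (-t ^ 2 / 2))) := by
  have hb' : (1 : ℝ) < b := by exact_mod_cast hb
  set Φ : ℝ → ℝ := fun z ↦ (1 / √(2 * π)) * ∫ t in (-z)..z, Real.exp (-t ^ 2 / 2) with hΦ
  have hcont : Continuous Φ := continuous_intervalIntegral_neg_self
  change Tendsto (fun x : ℕ ↦ (((range x).filter (DigitSumWithin b y)).card : ℝ) / x) atTop
    (nhds (Φ y))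
  rw [Metric.tendsto_nhds]
  intro ε hε
  obtain ⟨η, hη, hball⟩ := Metric.continuous_iff.1 hcont y (ε / 3) (by positivity)
  obtain ⟨δ, hδ0, hδ⟩ := exists_between (lt_min hη hy)
  obtain ⟨hδη, hδy⟩ := lt_min_iff.1 hδ
  obtain ⟨r, hr⟩ : ∃ r : ℕ, 2 / (b : ℝ) ^ r < ε / 3 := by
    obtain ⟨r, hr⟩ := pow_unbounded_of_one_lt (2 / (ε / 3)) hb'
    refine ⟨r, ?_⟩
    rw [div_lt_iff₀ (by positivity)] at hr ⊢
    linarith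
  have hr' : 1 / (b : ℝ) ^ r ≤ 2 / (b : ℝ) ^ r := by gcongr; norm_num
  have hm := tendsto_log_sub_atTop hb r
  have hplus := ((tendsto_centralProportion hb (z := y + δ) (by linarith)).comp hm).eventually
    (Metric.ball_mem_nhds _ (by positivity : 0 < ε / 3))
  have hminus := ((tendsto_centralProportion hb (z := y - δ) (by linarith)).comp hm).eventually
    (Metric.ball_mem_nhds _ (by positivity : 0 < ε / 3))
  have hΦ₁ := hball (y + δ) (by simpa [abs_of_pos hδ0] using hδη)
  have hΦ₂ := hball (y - δ) (by simpa [Real.dist_eq, abs_of_pos hδ0] using hδη)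
  have hmain := eventually_digitSumWithin_proportion hb hy hδ0 r
  filter_upwards [hplus, hminus, hmain] with x h1 h2 ⟨h3, h4⟩
  rw [Real.dist_eq, abs_lt, Function.comp_apply] at h1 h2
  rw [Real.dist_eq, abs_lt] at hΦ₁ hΦ₂
  rw [Real.dist_eq, abs_lt]
  simp only [hΦ] at hΦ₁ hΦ₂ ⊢
  constructor <;> linarith
end

section
/- For all sufficiently large integers L, the number of natural numbers n < 3^L with s_3(n) = ⌊L·log 3/log 4⌋ is at least 3^{0.970359238·L}. -/
open Filter Finset

theorem digitSum_three_mul_add (m : ℕ) {d : ℕ} (hd : d < 3) :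
    digitSum 3 (3 * m + d) = digitSum 3 m + d := by
  unfold digitSum
  rcases Nat.eq_zero_or_pos (3 * m + d) with h | h
  · obtain ⟨rfl, rfl⟩ : m = 0 ∧ d = 0 := by omega
    simp
  · rw [Nat.digits_def' (by norm_num) h, List.sum_cons, add_comm]
    congr 3 <;> omega

theorem sum_range_three_mul (f : ℕ → ℕ) (N : ℕ) :
    ∑ n ∈ range (3 * N), f n
      = ∑ m ∈ range N, f (3 * m) + ∑ m ∈ range N, f (3 * m + 1) + ∑ m ∈ range N, f (3 * m + 2) := by
  induction N with
  | zero => simp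
  | succ N ih =>
    rw [show 3 * (N + 1) = 3 * N + 1 + 1 + 1 by ring]
    simp only [sum_range_succ, ih]
    ring

/-- The number of `n < 3 ^ L` whose ternary digit sum is `k`. -/
def digitSumCount (L k : ℕ) : ℕ := #{n ∈ range (3 ^ L) | digitSum 3 n = k}

theorem digitSumCount_zero_zero : digitSumCount 0 0 = 1 := by
  simp [digitSumCount, digitSum, filter_singleton]

theorem digitSumCount_succ (L k : ℕ) :
    digitSumCount (L + 1) k = digitSumCount L k
      + (∑ m ∈ range (3 ^ L), if digitSum 3 m + 1 = k then 1 else 0)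
      + ∑ m ∈ range (3 ^ L), if digitSum 3 m + 2 = k then 1 else 0 := by
  simp only [digitSumCount, card_filter]
  rw [pow_succ', sum_range_three_mul]
  have h0 (m : ℕ) : digitSum 3 (3 * m) = digitSum 3 m :=
    digitSum_three_mul_add m (d := 0) (by norm_num)
  simp only [h0, digitSum_three_mul_add _ (show 1 < 3 by norm_num),
    digitSum_three_mul_add _ (show 2 < 3 by norm_num)]

theorem factorial_le_digitSumCount_mul (L a b c : ℕ) (h : a + b + c = L) :
    L.factorial ≤ digitSumCount L (b + 2 * c) * (a.factorial * b.factorial * c.factorial) := by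
  induction L generalizing a b c with
  | zero =>
    obtain ⟨rfl, rfl, rfl⟩ : a = 0 ∧ b = 0 ∧ c = 0 := by omega
    simp [digitSumCount_zero_zero]
  | succ L ih =>
    have ha : a * L.factorial
        ≤ digitSumCount L (b + 2 * c) * (a.factorial * b.factorial * c.factorial) := by
      cases a with
      | zero => simp
      | succ a =>
        refine (Nat.mul_le_mul_left (a + 1) (ih a b c (by omega))).trans_eq ?_
        rw [Nat.factorial_succ a]
        ring
    have hb : b * L.factorial
        ≤ (∑ m ∈ range (3 ^ L), if digitSum 3 m + 1 = b + 2 * c then 1 else 0)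
          * (a.factorial * b.factorial * c.factorial) := by
      cases b with
      | zero => simp
      | succ b =>
        have e (m : ℕ) : digitSum 3 m + 1 = b + 1 + 2 * c ↔ digitSum 3 m = b + 2 * c := by omega
        simp only [e, ← card_filter]
        refine (Nat.mul_le_mul_left (b + 1) (ih a b c (by omega))).trans_eq ?_
        rw [Nat.factorial_succ b, digitSumCount]
        ring
    have hc : c * L.factorial
        ≤ (∑ m ∈ range (3 ^ L), if digitSum 3 m + 2 = b + 2 * c then 1 else 0)
          * (a.factorial * b.factorial * c.factorial) := by
      cases c with
      | zero => simp
      | succ c =>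
        have e (m : ℕ) : digitSum 3 m + 2 = b + 2 * (c + 1) ↔ digitSum 3 m = b + 2 * c := by omega
        simp only [e, ← card_filter]
        refine (Nat.mul_le_mul_left (c + 1) (ih a b c (by omega))).trans_eq ?_
        rw [Nat.factorial_succ c, digitSumCount]
        ring
    rw [Nat.factorial_succ, digitSumCount_succ, ← h]
    linarith

open Real Topology in
theorem tendsto_log_factorial_div_sub_log :
    Tendsto (fun n : ℕ => log n.factorial / n - log n) atTop (𝓝 (-1)) := by
  have hS : Tendsto (fun n : ℕ => log (Stirling.stirlingSeq n) / n) atTop (𝓝 0) :=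
    ((continuousAt_log (by positivity)).tendsto.comp
      Stirling.tendsto_stirlingSeq_sqrt_pi).div_atTop tendsto_natCast_atTop_atTop
  have hl : Tendsto (fun n : ℕ => log n / n) atTop (𝓝 0) :=
    isLittleO_log_id_atTop.tendsto_div_nhds_zero.comp tendsto_natCast_atTop_atTop
  have hc : Tendsto (fun n : ℕ => 1 / 2 * log 2 / n) atTop (𝓝 0) :=
    tendsto_const_nhds.div_atTop tendsto_natCast_atTop_atTop
  have key := ((hS.add hc).add (hl.const_mul (1 / 2))).sub_const 1
  norm_num at key
  refine key.congr' ?_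
  filter_upwards [eventually_gt_atTop 0] with n hn
  have hn' : (n : ℝ) ≠ 0 := by positivity
  rw [Stirling.log_stirlingSeq_formula, log_mul (by norm_num) hn', log_div hn' (exp_ne_zero 1),
    log_exp]
  field_simp
  ring

open Real Topology in
theorem tendsto_log_factorial_div_sub_mul_log {u : ℕ → ℕ} {p : ℝ} (hp : 0 < p)
    (hu : Tendsto (fun L : ℕ => (u L : ℝ) / L) atTop (𝓝 p)) :
    Tendsto (fun L : ℕ => log (u L).factorial / L - u L / L * log L) atTop
      (𝓝 (-p - negMulLog p)) := by
  have hinf : Tendsto u atTop atTop := by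
    have h := hu.pos_mul_atTop hp tendsto_natCast_atTop_atTop
    refine tendsto_natCast_atTop_iff.mp (h.congr' ?_)
    filter_upwards [eventually_gt_atTop 0] with L hL
    field_simp
  have h1 := hu.mul (tendsto_log_factorial_div_sub_log.comp hinf)
  have h2 := (continuous_negMulLog.tendsto p).comp hu
  have key := h1.sub h2
  rw [mul_neg_one] at key
  refine key.congr' ?_
  filter_upwards [eventually_gt_atTop 0, hinf.eventually_gt_atTop 0] with L hL huL
  have hL' : (L : ℝ) ≠ 0 := by positivity
  have hu' : (u L : ℝ) ≠ 0 := by positivity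
  simp only [Function.comp, negMulLog, log_div hu' hL']
  field_simp
  ring

open Real Topology in
/-- The exponential growth rate of a trinomial coefficient is the entropy of its type. -/
theorem tendsto_log_trinomial_div {u v w : ℕ → ℕ} {p q r : ℝ} (hp : 0 < p) (hq : 0 < q)
    (hr : 0 < r) (hu : Tendsto (fun L : ℕ => (u L : ℝ) / L) atTop (𝓝 p))
    (hv : Tendsto (fun L : ℕ => (v L : ℝ) / L) atTop (𝓝 q))
    (hw : Tendsto (fun L : ℕ => (w L : ℝ) / L) atTop (𝓝 r))
    (hsum : ∀ᶠ L in atTop, u L + v L + w L = L) :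
    Tendsto (fun L : ℕ => (log L.factorial - log (u L).factorial - log (v L).factorial
      - log (w L).factorial) / L) atTop (𝓝 (negMulLog p + negMulLog q + negMulLog r)) := by
  have hpqr : p + q + r = 1 := by
    refine tendsto_nhds_unique ((hu.add hv).add hw) (tendsto_const_nhds.congr' ?_)
    filter_upwards [hsum, eventually_gt_atTop 0] with L h hL
    have h' : (u L : ℝ) + v L + w L = L := mod_cast h
    rw [← add_div, ← add_div, h', div_self (by positivity)]
  have key := ((tendsto_log_factorial_div_sub_log.sub
    (tendsto_log_factorial_div_sub_mul_log hp hu)).sub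
    (tendsto_log_factorial_div_sub_mul_log hq hv)).sub
    (tendsto_log_factorial_div_sub_mul_log hr hw)
  rw [show -1 - (-p - negMulLog p) - (-q - negMulLog q) - (-r - negMulLog r)
    = negMulLog p + negMulLog q + negMulLog r by linear_combination hpqr] at key
  refine key.congr' ?_
  filter_upwards [hsum, eventually_gt_atTop 0] with L h hL
  have h' : (u L : ℝ) + v L + w L = L := mod_cast h
  have hL' : (L : ℝ) ≠ 0 := by positivity
  field_simp
  linear_combination log L * h'

open Real in
theorem log_div_mem_Icc {x : ℝ} (h₀ : 0 ≤ x) (h : x < 1) (n : ℕ) :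
    log ((1 + x) / (1 - x)) ∈ Set.Icc (2 * ∑ i ∈ range n, x ^ (2 * i + 1) / (2 * i + 1))
      (2 * (∑ i ∈ range n, x ^ (2 * i + 1) / (2 * i + 1) + x ^ (2 * n + 1) / (1 - x ^ 2))) := by
  constructor
  · linarith [sum_range_le_log_div h₀ h n]
  · linarith [log_div_le_sum_range_add h₀ h n]

open Real in
theorem neg_log_sub_le_negMulLog {p q : ℝ} (hp : 0 < p) (hq : 0 < q) :
    -(p * log q) - p * (p - q) / q ≤ negMulLog p := by
  have h := mul_le_mul_of_nonneg_left (log_le_sub_one_of_pos (div_pos hp hq)) hp.le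
  rw [log_div hp.ne' hq.ne'] at h
  rw [negMulLog]
  have e : p * (p - q) / q = p * (p / q - 1) := by field_simp
  linarith

open Real in
theorem lt_entropy_of_mean_log_three_div_log_four {a : ℝ} (ha : a = log 3 / log 4) :
    0.7924 < a ∧ a < 0.7925 ∧
    0.970359238 * log 3 < negMulLog (1 - a + 100489 / 427609)
      + negMulLog (a - 2 * (100489 / 427609)) + negMulLog (100489 / 427609) := by
  obtain ⟨l2, u2⟩ := log_div_mem_Icc (x := 1 / 3) (by norm_num) (by norm_num) 14
  obtain ⟨l3, u3⟩ := log_div_mem_Icc (x := 1 / 5) (by norm_num) (by norm_num) 10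
  -- `log x` and `log (1 + x + x ^ 2)` at the near-optimal tilt `x = 317 / 435`
  obtain ⟨lx, -⟩ := log_div_mem_Icc (x := 59 / 376) (by norm_num) (by norm_num) 8
  obtain ⟨lz, -⟩ := log_div_mem_Icc (x := 7411 / 3413461) (by norm_num) (by norm_num) 3
  norm_num [sum_range_succ] at l2 u2 l3 u3 lx lz
  rw [log_div (by norm_num) (by norm_num)] at l3 u3 lx lz
  replace l2 : 0.693147180559 < log 2 := by linarith
  replace u2 : log 2 < 0.693147180561 := by linarith
  replace l3 : 1.098612288667 < log 3 := by linarith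
  replace u3 : log 3 < 1.098612288670 := by linarith
  have e4 : log 4 = 2 * log 2 := by
    rw [show (4 : ℝ) = 2 ^ 2 by norm_num, log_pow, Nat.cast_ofNat]
  have ha' : a * (2 * log 2) = log 3 := by
    rw [ha, e4, div_mul_cancel₀ _ (by linarith)]
  have la : 0.792481250358 < a := by nlinarith
  have ua : a < 0.79248125037 := by nlinarith
  refine ⟨by linarith, by linarith, ?_⟩
  have h0 := neg_log_sub_le_negMulLog (p := 1 - a + 100489 / 427609) (q := 189225 / 427609)
    (by linarith) (by norm_num)
  have h1 := neg_log_sub_le_negMulLog (p := a - 2 * (100489 / 427609)) (q := 137895 / 427609)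
    (by linarith) (by norm_num)
  have h2 := neg_log_sub_le_negMulLog (p := 100489 / 427609) (q := 100489 / 427609)
    (by norm_num) (by norm_num)
  have e0 : log (189225 / 427609) = 2 * log 435 - log 427609 := by
    rw [log_div (by norm_num) (by norm_num), show (189225 : ℝ) = 435 ^ 2 by norm_num, log_pow]
    norm_num
  have e1 : log (137895 / 427609) = log 317 + log 435 - log 427609 := by
    rw [log_div (by norm_num) (by norm_num), show (137895 : ℝ) = 317 * 435 by norm_num,
      log_mul (by norm_num) (by norm_num)]
  have e2 : log (100489 / 427609) = 2 * log 317 - log 427609 := by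
    rw [log_div (by norm_num) (by norm_num), show (100489 : ℝ) = 317 ^ 2 by norm_num, log_pow]
    norm_num
  have ez : log 1710436 = 2 * log 2 + log 427609 := by
    rw [show (1710436 : ℝ) = 2 ^ 2 * 427609 by norm_num, log_mul (by norm_num) (by norm_num),
      log_pow]
    norm_num
  have ez' : log 1703025 = 2 * log 3 + 2 * log 435 := by
    rw [show (1703025 : ℝ) = 3 ^ 2 * 435 ^ 2 by norm_num, log_mul (by norm_num) (by norm_num),
      log_pow, log_pow]
    norm_num
  rw [e0] at h0
  rw [e1] at h1
  rw [e2] at h2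
  rw [ez, ez'] at lz
  have hx : 0.316444257211 < log 435 - log 317 := by linarith
  have hz : 0.004342227225 < 2 * log 2 + log 427609 - (2 * log 3 + 2 * log 435) := by linarith
  have hax : 0.792481250358 * 0.316444257211 < a * (log 435 - log 317) := by
    apply mul_lt_mul'' la hx <;> norm_num
  have hs : (1 - a + 100489 / 427609) * (1 - a + 100489 / 427609 - 189225 / 427609)
        / (189225 / 427609)
      + (a - 2 * (100489 / 427609)) * (a - 2 * (100489 / 427609) - 137895 / 427609)
        / (137895 / 427609)
      < 1 / 10 ^ 10 := by
    have : (a - 338873 / 427609) ^ 2 < 1 / 10 ^ 11 := by nlinarith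
    linarith
  linarith

/-- Lower bound for the tail of the distribution of `s₃`: for large `L`, the number of
`n < 3^L` with `s₃(n) = ⌊L·log 3/log 4⌋` is at least `3^(0.970359238·L)`. -/
theorem tail_bound_s3 :
    ∀ᶠ L : ℕ in atTop,
      (3 : ℝ) ^ (0.970359238 * (L : ℝ))
        ≤ (((Finset.range (3 ^ L)).filter (fun n =>
            digitSum 3 n = ⌊(L : ℝ) * Real.log 3 / Real.log 4⌋₊)).card : ℝ) := by
  obtain ⟨a, ha⟩ : ∃ a, a = Real.log 3 / Real.log 4 := ⟨_, rfl⟩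
  obtain ⟨la, ua, hH⟩ := lt_entropy_of_mean_log_three_div_log_four ha
  obtain ⟨r, lr, ur, hH⟩ : ∃ r : ℝ, 0.235 < r ∧ r < 0.2351 ∧ 0.970359238 * Real.log 3
      < Real.negMulLog (1 - a + r) + Real.negMulLog (a - 2 * r) + Real.negMulLog r :=
    ⟨_, by norm_num, by norm_num, hH⟩
  have floor_lim {t : ℝ} (ht : 0 ≤ t) :
      Tendsto (fun L : ℕ => (⌊t * L⌋₊ : ℝ) / L) atTop (nhds t) :=
    (tendsto_nat_floor_mul_div_atTop ht).comp tendsto_natCast_atTop_atTop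
  have hk := floor_lim (show 0 ≤ a by linarith)
  have hw := floor_lim (show 0 ≤ r by linarith)
  set k : ℕ → ℕ := fun L => ⌊a * L⌋₊
  set w : ℕ → ℕ := fun L => ⌊r * L⌋₊
  have hle : ∀ᶠ L in atTop, 2 * w L ≤ k L ∧ k L ≤ L + w L := by
    filter_upwards [(hw.const_mul 2).eventually_lt hk (by linarith),
      hk.eventually_lt (hw.const_add 1) (by linarith), eventually_gt_atTop 0] with L h1 h2 hL
    have hL' : (0 : ℝ) < L := mod_cast hL
    constructor
    · rw [← mul_div_assoc, div_lt_div_iff_of_pos_right hL'] at h1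
      exact_mod_cast h1.le
    · rw [← div_self hL'.ne', ← add_div, div_lt_div_iff_of_pos_right hL'] at h2
      exact_mod_cast h2.le
  have hv : Tendsto (fun L => ((k L - 2 * w L : ℕ) : ℝ) / L) atTop (nhds (a - 2 * r)) := by
    refine (hk.sub (hw.const_mul 2)).congr' ?_
    filter_upwards [hle] with L h
    rw [Nat.cast_sub h.1]
    push_cast
    ring
  have hu : Tendsto (fun L => ((L + w L - k L : ℕ) : ℝ) / L) atTop (nhds (1 - a + r)) := by
    rw [show 1 - a + r = 1 + r - a by ring]
    refine ((hw.const_add 1).sub hk).congr' ?_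
    filter_upwards [hle, eventually_gt_atTop 0] with L h hL
    rw [Nat.cast_sub h.2]
    push_cast
    rw [sub_div, add_div, div_self (by positivity)]
  have hsum : ∀ᶠ L in atTop, (L + w L - k L) + (k L - 2 * w L) + w L = L := by
    filter_upwards [hle] with L h
    omega
  have key := tendsto_log_trinomial_div (by linarith) (by linarith) (by linarith) hu hv hw hsum
  filter_upwards [key.eventually_const_lt hH, hsum, hle, eventually_gt_atTop 0] with L h hs hl hL
  have hL' : (0 : ℝ) < L := mod_cast hL
  rw [lt_div_iff₀ hL'] at h
  have hcount := factorial_le_digitSumCount_mul L _ _ _ hs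
  rw [show k L - 2 * w L + 2 * w L = k L by omega] at hcount
  have hcount' : (L.factorial : ℝ) ≤ digitSumCount L (k L) * ((L + w L - k L).factorial
      * (k L - 2 * w L).factorial * (w L).factorial) := mod_cast hcount
  have hpos : (0 : ℝ) < digitSumCount L (k L) := by
    refine pos_of_mul_pos_left (lt_of_lt_of_le ?_ hcount') (by positivity)
    positivity
  have hlog := Real.log_le_log (by positivity) hcount'
  rw [Real.log_mul (by positivity) (by positivity), Real.log_mul (by positivity) (by positivity),
    Real.log_mul (by positivity) (by positivity)] at hlog
  rw [show (L : ℝ) * Real.log 3 / Real.log 4 = a * L by rw [ha]; ring]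
  change _ ≤ (digitSumCount L (k L) : ℝ)
  rw [← Real.log_le_log_iff (by positivity) hpos, Real.log_rpow (by norm_num)]
  linarith
end

section
/- For all sufficiently large integers L, setting ℓ₂ = ⌊0.235001144·L⌋, ℓ₁ = ⌊L·log 3/log 4⌋ − 2ℓ₂, and ℓ₀ = L − ℓ₁ − ℓ₂, the multinomial coefficient L!/(ℓ₀!·ℓ₁!·ℓ₂!) is at least 3^{0.970359238·L}. -/
open Filter

/-- Upper Stirling-type bound, without the square-root saving. -/
theorem log_factorial_le_of_le {k n : ℕ} (hk : k ≤ n) :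
    Real.log (k.factorial : ℝ) ≤ k * Real.log k - k + (1 + Real.log n) := by
  have hlogn : 0 ≤ Real.log n := Real.log_natCast_nonneg n
  rcases k with _ | k
  · simp; linarith
  have hanti := Stirling.log_stirlingSeq'_antitone (Nat.zero_le k)
  have hkpos : (0 : ℝ) < (k + 1 : ℕ) := by positivity
  have hlogk : Real.log ((k + 1 : ℕ) : ℝ) ≤ Real.log n :=
    Real.log_le_log hkpos (by exact_mod_cast hk)
  have hlogk0 : 0 ≤ Real.log ((k + 1 : ℕ) : ℝ) := Real.log_natCast_nonneg _
  simp only [Function.comp_apply, Nat.succ_eq_add_one, zero_add] at hanti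
  rw [Stirling.log_stirlingSeq_formula, Stirling.log_stirlingSeq_formula,
    Real.log_div hkpos.ne' (Real.exp_pos 1).ne', Real.log_mul two_ne_zero hkpos.ne'] at hanti
  simp only [Real.log_exp, Nat.factorial_one, Nat.cast_one, Real.log_one, mul_one, one_div,
    Real.log_inv] at hanti
  linarith

theorem le_log_factorial (n : ℕ) :
    n * Real.log n - n ≤ Real.log (n.factorial : ℝ) := by
  rcases eq_or_ne n 0 with rfl | hn
  · simp
  have h := Stirling.le_log_factorial_stirling hn
  have h₁ : 0 ≤ Real.log n := Real.log_natCast_nonneg n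
  have h₂ : 0 ≤ Real.log (2 * Real.pi) := Real.log_nonneg (by linarith [Real.pi_gt_three])
  linarith

theorem mul_negMulLog_div (k : ℕ) {x : ℝ} (hx : 0 < x) :
    x * Real.negMulLog (k / x) = k * Real.log x - k * Real.log k := by
  rcases eq_or_ne k 0 with rfl | hk
  · simp
  have hk' : (k : ℝ) ≠ 0 := by exact_mod_cast hk
  rw [Real.negMulLog, Real.log_div hk' hx.ne']
  field_simp
  ring

theorem factorial_mul_mul_dvd (a b c : ℕ) :
    a.factorial * b.factorial * c.factorial ∣ (a + b + c).factorial :=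
  (mul_dvd_mul_right (Nat.factorial_mul_factorial_dvd_factorial_add a b) _).trans
    (Nat.factorial_mul_factorial_dvd_factorial_add (a + b) c)

/-- Entropy lower bound for trinomial coefficients, up to a logarithmic error. -/
theorem entropy_le_log_trinomial {a b c n : ℕ} (h : a + b + c = n) (hn : n ≠ 0) :
    n * (Real.negMulLog (a / n) + Real.negMulLog (b / n) + Real.negMulLog (c / n))
        - 3 * (1 + Real.log n) ≤
      Real.log ((n.factorial / (a.factorial * b.factorial * c.factorial) : ℕ) : ℝ) := by
  have hn' : (0 : ℝ) < n := by exact_mod_cast Nat.pos_of_ne_zero hn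
  have hne (k : ℕ) : (k.factorial : ℝ) ≠ 0 := by exact_mod_cast k.factorial_ne_zero
  have hsum : (a : ℝ) + b + c = n := by exact_mod_cast h
  rw [Nat.cast_div (h ▸ factorial_mul_mul_dvd a b c) (by push_cast; simp [hne])]
  push_cast
  rw [Real.log_div (hne n) (by simp [hne]), Real.log_mul (by simp [hne]) (hne c),
    Real.log_mul (hne a) (hne b), mul_add, mul_add, mul_negMulLog_div a hn',
    mul_negMulLog_div b hn', mul_negMulLog_div c hn']
  have h₀ := le_log_factorial n
  have h₁ := log_factorial_le_of_le (k := a) (n := n) (by omega)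
  have h₂ := log_factorial_le_of_le (k := b) (n := n) (by omega)
  have h₃ := log_factorial_le_of_le (k := c) (n := n) (by omega)
  have h₄ : (n : ℝ) * Real.log n = a * Real.log n + b * Real.log n + c * Real.log n := by
    rw [← hsum]; ring
  linarith

theorem one_add_div_one_sub_moebius {p : ℝ} (hp : 0 < p) :
    (1 + (1 - p) / (1 + p)) / (1 - (1 - p) / (1 + p)) = p⁻¹ := by
  have : (1 : ℝ) + p ≠ 0 := by positivity
  field_simp
  ring_nf
  exact mul_inv_cancel₀ hp.ne'

theorem two_mul_sum_le_neg_log {p : ℝ} (hp : 0 < p) (hp' : p ≤ 1) (n : ℕ) :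
    2 * ∑ i ∈ Finset.range n, ((1 - p) / (1 + p)) ^ (2 * i + 1) / (2 * i + 1) ≤ -Real.log p := by
  have h := Real.sum_range_le_log_div (x := (1 - p) / (1 + p))
    (div_nonneg (by linarith) (by linarith)) (by rw [div_lt_one (by linarith)]; linarith) n
  rw [one_add_div_one_sub_moebius hp, Real.log_inv] at h
  linarith

theorem neg_log_le_two_mul_sum {p : ℝ} (hp : 0 < p) (hp' : p ≤ 1) (n : ℕ) :
    -Real.log p ≤ 2 * (∑ i ∈ Finset.range n, ((1 - p) / (1 + p)) ^ (2 * i + 1) / (2 * i + 1) +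
      ((1 - p) / (1 + p)) ^ (2 * n + 1) / (1 - ((1 - p) / (1 + p)) ^ 2)) := by
  have h := Real.log_div_le_sum_range_add (x := (1 - p) / (1 + p))
    (div_nonneg (by linarith) (by linarith)) (by rw [div_lt_one (by linarith)]; linarith) n
  rw [one_add_div_one_sub_moebius hp, Real.log_inv] at h
  linarith

theorem log_three_bounds :
    1.09861228866 ≤ Real.log 3 ∧ Real.log 3 ≤ 1.09861228867 := by
  have h : Real.log 3 = -Real.log (1 / 3) := by simp
  rw [h]
  exact ⟨le_trans (by norm_num [Finset.sum_range_succ])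
      (two_mul_sum_le_neg_log (p := 1 / 3) (by norm_num) (by norm_num) 20),
    (neg_log_le_two_mul_sum (p := 1 / 3) (by norm_num) (by norm_num) 20).trans
      (by norm_num [Finset.sum_range_succ])⟩

theorem log_two_bounds :
    0.69314718055 ≤ Real.log 2 ∧ Real.log 2 ≤ 0.693147180563 := by
  have h : Real.log 2 = -Real.log (1 / 2) := by simp
  rw [h]
  exact ⟨le_trans (by norm_num [Finset.sum_range_succ])
      (two_mul_sum_le_neg_log (p := 1 / 2) (by norm_num) (by norm_num) 12),
    (neg_log_le_two_mul_sum (p := 1 / 2) (by norm_num) (by norm_num) 12).trans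
      (by norm_num [Finset.sum_range_succ])⟩

theorem log_three_div_log_four_bounds :
    0.79248125034 ≤ Real.log 3 / Real.log 4 ∧ Real.log 3 / Real.log 4 ≤ 0.7924812504 := by
  have h : Real.log 4 = 2 * Real.log 2 := by
    rw [show (4 : ℝ) = 2 ^ 2 by norm_num, Real.log_pow]; norm_num
  obtain ⟨h₁, h₂⟩ := log_three_bounds
  obtain ⟨h₃, h₄⟩ := log_two_bounds
  rw [h, le_div_iff₀ (by linarith), div_le_iff₀ (by linarith)]
  constructor <;> linarith

theorem mul_le_negMulLog {a p l : ℝ} (ha : 0 < a) (hap : a ≤ p) (hl : l ≤ -Real.log p) :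
    a * l ≤ Real.negMulLog a := by
  rw [Real.negMulLog, neg_mul_comm]
  exact mul_le_mul_of_nonneg_left (hl.trans (neg_le_neg (Real.log_le_log ha hap))) ha.le

theorem mul_log_three_lt_entropy :
    0.970359238 * Real.log 3 <
      Real.negMulLog (1 - (Real.log 3 / Real.log 4 - 2 * 0.235001144) - 0.235001144) +
        Real.negMulLog (Real.log 3 / Real.log 4 - 2 * 0.235001144) +
        Real.negMulLog 0.235001144 := by
  obtain ⟨h₁, h₂⟩ := log_three_div_log_four_bounds
  have h₃ := log_three_bounds.2
  set t := Real.log 3 / Real.log 4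
  have e₀ : (1 - (t - 2 * 0.235001144) - 0.235001144) * 0.815269858026 ≤
      Real.negMulLog (1 - (t - 2 * 0.235001144) - 0.235001144) :=
    mul_le_negMulLog (p := 0.4425198937) (by linarith) (by linarith)
      (le_trans (by norm_num [Finset.sum_range_succ])
        (two_mul_sum_le_neg_log (by norm_num) (by norm_num) 12))
  have e₁ : (t - 2 * 0.235001144) * 1.13171737774 ≤
      Real.negMulLog (t - 2 * 0.235001144) :=
    mul_le_negMulLog (p := 0.3224789624) (by linarith) (by linarith)
      (le_trans (by norm_num [Finset.sum_range_succ])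
        (two_mul_sum_le_neg_log (by norm_num) (by norm_num) 18))
  have e₂ : 0.235001144 * 1.4481648967 ≤ Real.negMulLog 0.235001144 :=
    mul_le_negMulLog (p := 0.235001144) (by norm_num) le_rfl
      (le_trans (by norm_num [Finset.sum_range_succ])
        (two_mul_sum_le_neg_log (by norm_num) (by norm_num) 22))
  linarith

theorem tendsto_floor_mul_natCast_div {x : ℝ} (hx : 0 ≤ x) :
    Tendsto (fun n : ℕ => (⌊x * n⌋₊ : ℝ) / n) atTop (nhds x) :=
  (tendsto_nat_floor_mul_div_atTop hx).comp tendsto_natCast_atTop_atTop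

theorem tendsto_one_add_log_div_natCast :
    Tendsto (fun n : ℕ => (1 + Real.log n) / (n : ℝ)) atTop (nhds 0) := by
  have h₁ : Tendsto (fun n : ℕ => Real.log n / (n : ℝ)) atTop (nhds 0) :=
    Real.isLittleO_log_id_atTop.tendsto_div_nhds_zero.comp tendsto_natCast_atTop_atTop
  have h₂ := tendsto_one_div_atTop_nhds_zero_nat (𝕜 := ℝ)
  simpa [add_div] using h₂.add h₁

/-- For large `L`, with `ℓ₂ = ⌊0.235001144·L⌋`, `ℓ₁ = ⌊L·log 3/log 4⌋ − 2ℓ₂` and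
`ℓ₀ = L − ℓ₁ − ℓ₂`, the multinomial coefficient `L!/(ℓ₀!·ℓ₁!·ℓ₂!)` is at least
`3^(0.970359238·L)`. -/
theorem multinomial_term_lower_bound :
    ∀ᶠ L : ℕ in atTop,
      (3 : ℝ) ^ (0.970359238 * (L : ℝ)) ≤
        ((L.factorial /
          ((L - (⌊(L : ℝ) * Real.log 3 / Real.log 4⌋₊ - 2 * ⌊(0.235001144 : ℝ) * L⌋₊)
              - ⌊(0.235001144 : ℝ) * L⌋₊).factorial *
            (⌊(L : ℝ) * Real.log 3 / Real.log 4⌋₊ - 2 * ⌊(0.235001144 : ℝ) * L⌋₊).factorial *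
            (⌊(0.235001144 : ℝ) * L⌋₊).factorial) : ℕ) : ℝ) := by
  set t := Real.log 3 / Real.log 4 with ht
  obtain ⟨ht₁, ht₂⟩ := log_three_div_log_four_bounds
  rw [← ht] at ht₁ ht₂
  have hA := tendsto_floor_mul_natCast_div (x := t) (by linarith)
  have hB := tendsto_floor_mul_natCast_div (x := 0.235001144) (by norm_num)
  have hm := hA.sub (hB.const_mul 2)
  have hk := (hm.const_sub 1).sub hB
  have hlim := ((((Real.continuous_negMulLog.tendsto _).comp hk).add
    ((Real.continuous_negMulLog.tendsto _).comp hm)).add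
    ((Real.continuous_negMulLog.tendsto _).comp hB)).sub
    (tendsto_one_add_log_div_natCast.const_mul 3)
  rw [mul_zero, sub_zero] at hlim
  filter_upwards [hlim.eventually_const_lt mul_log_three_lt_entropy,
    hm.eventually_const_lt (show (0 : ℝ) < t - 2 * 0.235001144 by linarith),
    hk.eventually_const_lt (show (0 : ℝ) < 1 - (t - 2 * 0.235001144) - 0.235001144 by linarith),
    eventually_ne_atTop 0] with L hL hm₀ hk₀ hL₀
  have hpos : (0 : ℝ) < L := by exact_mod_cast Nat.pos_of_ne_zero hL₀
  rw [mul_div_assoc, ← ht, mul_comm (L : ℝ) t]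
  simp only [Function.comp_apply] at hL
  set A := ⌊t * (L : ℝ)⌋₊
  set B := ⌊(0.235001144 : ℝ) * L⌋₊
  have hAB : 2 * B ≤ A := by
    have h : (A : ℝ) / L - 2 * (B / L) = (A - 2 * B) / L := by ring
    rw [h, div_pos_iff_of_pos_right hpos] at hm₀
    have : (2 * B : ℝ) ≤ A := by linarith
    exact_mod_cast this
  have hmcast : ((A - 2 * B : ℕ) : ℝ) / L = A / L - 2 * (B / L) := by
    push_cast [Nat.cast_sub hAB]; ring
  have hmB : A - 2 * B + B ≤ L := by
    have h : 1 - ((A : ℝ) / L - 2 * (B / L)) - B / L = (L - ((A - 2 * B : ℕ) + B)) / L := by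
      rw [← hmcast]; field_simp; ring
    rw [h, div_pos_iff_of_pos_right hpos] at hk₀
    have : (((A - 2 * B : ℕ) : ℝ) + B) ≤ L := by linarith
    exact_mod_cast this
  have hkcast : ((L - (A - 2 * B) - B : ℕ) : ℝ) / L =
      1 - (A / L - 2 * (B / L)) - B / L := by
    rw [← hmcast, Nat.sub_sub, Nat.cast_sub hmB]
    push_cast
    field_simp
    ring
  have hsum : L - (A - 2 * B) - B + (A - 2 * B) + B = L := by omega
  have hent := entropy_le_log_trinomial hsum hL₀
  rw [hmcast, hkcast] at hent
  have hcoef : (0 : ℝ) < ((L.factorial / ((L - (A - 2 * B) - B).factorial *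
      (A - 2 * B).factorial * B.factorial) : ℕ) : ℝ) := by
    have hdvd := factorial_mul_mul_dvd (L - (A - 2 * B) - B) (A - 2 * B) B
    rw [hsum] at hdvd
    exact_mod_cast Nat.div_pos (Nat.le_of_dvd L.factorial_pos hdvd) (by positivity)
  rw [Real.rpow_def_of_pos (by norm_num), ← Real.le_log_iff_exp_le hcoef]
  refine le_trans ?_ hent
  have h := (mul_lt_mul_of_pos_left hL hpos).le
  rw [mul_sub, mul_left_comm (L : ℝ) 3, mul_div_cancel₀ _ hpos.ne'] at h
  linarith
end

section
/- For all sufficiently large integers N, setting K = ⌊log N/log 3⌋ − 2 and H = ⌊(K−1)·log 3/log 4⌋ + 2, the number of natural numbers n ≤ 2^{2H} with |s_2(n) − H| ≥ 0.14572049·(log 4)·H is at most 2^{0.970359230·2H}, which is at most N^{0.970359230}. -/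
open Filter Finset

lemma digitSum_two_mul (n : ℕ) : digitSum 2 (2 * n) = digitSum 2 n := by
  rcases Nat.eq_zero_or_pos n with rfl | hn
  · simp
  · simp [digitSum, Nat.digits_base_mul one_lt_two hn]

lemma digitSum_two_mul_add_one (n : ℕ) : digitSum 2 (2 * n + 1) = digitSum 2 n + 1 := by
  have h := Nat.digits_add 2 one_lt_two 1 n one_lt_two (Or.inl one_ne_zero)
  rw [digitSum, digitSum, add_comm (2 * n), h, List.sum_cons, add_comm]

lemma sum_range_two_mul_eq_sum_pairs (f : ℕ → ℝ) (k : ℕ) :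
    ∑ i ∈ range (2 * k), f i = ∑ i ∈ range k, (f (2 * i) + f (2 * i + 1)) := by
  induction k with
  | zero => simp
  | succ k ih =>
    rw [show 2 * (k + 1) = 2 * k + 1 + 1 by ring, sum_range_succ, sum_range_succ, ih,
      sum_range_succ, add_assoc]

/-- The generating function of the binary digit sum over `[0, 2 ^ m)`. -/
lemma sum_pow_digitSum_two (x : ℝ) (m : ℕ) :
    ∑ n ∈ range (2 ^ m), x ^ digitSum 2 n = (1 + x) ^ m := by
  induction m with
  | zero => simp [digitSum]
  | succ m ih =>
    rw [pow_succ', sum_range_two_mul_eq_sum_pairs, pow_succ, ← ih, sum_mul]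
    refine sum_congr rfl fun n _ => ?_
    rw [digitSum_two_mul, digitSum_two_mul_add_one]
    ring

/-- Chernoff's bound for the deviation of the binary digit sum on `[0, 2 ^ (2 * H))`,
with tilting parameter `x`. -/
lemma card_digitSum_two_deviation_le {x : ℝ} (hx : 1 ≤ x) (c : ℝ) (H : ℕ) :
    (((range (2 ^ (2 * H))).filter
        (fun n => c * H ≤ |(digitSum 2 n : ℝ) - (H : ℝ)|)).card : ℝ)
      ≤ 2 * Real.exp ((2 * H) * (Real.log (1 + x) - (1 + c) / 2 * Real.log x)) := by
  have hx0 : 0 < x := by linarith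
  have hlog : 0 ≤ Real.log x := Real.log_nonneg hx
  set t := Real.log x with ht
  have hxe : x = Real.exp t := (Real.exp_log hx0).symm
  have hpow (n : ℕ) : Real.exp (n * t) = x ^ n := by rw [Real.exp_nat_mul, ← hxe]
  have hpow' (n : ℕ) : Real.exp (-(n * t)) = (x⁻¹) ^ n := by
    rw [Real.exp_neg, hpow, inv_pow]
  have hone : (1 + x) = Real.exp (Real.log (1 + x)) := (Real.exp_log (by linarith)).symm
  have hone' : (1 + x⁻¹) = Real.exp (Real.log (1 + x) - t) := by
    rw [Real.exp_sub, ← hone, ← hxe]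
    field_simp
    ring
  have key : ∀ n ∈ (range (2 ^ (2 * H))).filter
      (fun n => c * H ≤ |(digitSum 2 n : ℝ) - (H : ℝ)|),
      (1 : ℝ) ≤ x ^ digitSum 2 n * Real.exp (-(1 + c) * H * t)
        + (x⁻¹) ^ digitSum 2 n * Real.exp ((1 - c) * H * t) := by
    intro n hn
    have hn := (mem_filter.1 hn).2
    rw [← hpow, ← hpow', ← Real.exp_add, ← Real.exp_add]
    rcases le_abs.1 hn with h | h
    · have h1 := mul_le_mul_of_nonneg_right h hlog
      have h2 := Real.one_le_exp
        (show 0 ≤ (digitSum 2 n : ℝ) * t + -(1 + c) * H * t by linarith)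
      linarith [Real.exp_pos (-((digitSum 2 n : ℝ) * t) + (1 - c) * H * t)]
    · have h1 := mul_le_mul_of_nonneg_right h hlog
      have h2 := Real.one_le_exp
        (show 0 ≤ -((digitSum 2 n : ℝ) * t) + (1 - c) * H * t by linarith)
      linarith [Real.exp_pos ((digitSum 2 n : ℝ) * t + -(1 + c) * H * t)]
  calc _ = ∑ n ∈ (range (2 ^ (2 * H))).filter
        (fun n => c * H ≤ |(digitSum 2 n : ℝ) - (H : ℝ)|), (1 : ℝ) := by simp
    _ ≤ _ := sum_le_sum key
    _ ≤ ∑ n ∈ range (2 ^ (2 * H)), (x ^ digitSum 2 n * Real.exp (-(1 + c) * H * t)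
        + (x⁻¹) ^ digitSum 2 n * Real.exp ((1 - c) * H * t)) :=
      sum_le_sum_of_subset_of_nonneg (filter_subset _ _) fun _ _ _ => by positivity
    _ = _ := by
      rw [sum_add_distrib, ← sum_mul, ← sum_mul, sum_pow_digitSum_two, sum_pow_digitSum_two,
        hone, hone', ← Real.exp_nat_mul, ← Real.exp_nat_mul, ← Real.exp_add, ← Real.exp_add,
        Real.log_exp, two_mul (Real.exp _)]
      congr 2 <;> push_cast <;> ring

lemma log_le_of_eq_div {a y : ℝ} (h₀ : 0 ≤ y) (h₁ : y < 1) (h : a = (1 + y) / (1 - y)) (n : ℕ) :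
    Real.log a ≤
      2 * ((∑ i ∈ range n, y ^ (2 * i + 1) / (2 * i + 1)) + y ^ (2 * n + 1) / (1 - y ^ 2)) := by
  have := Real.log_div_le_sum_range_add h₀ h₁ n
  rw [h]
  linarith

lemma le_log_of_eq_div {a y : ℝ} (h₀ : 0 ≤ y) (h₁ : y < 1) (h : a = (1 + y) / (1 - y)) (n : ℕ) :
    2 * (∑ i ∈ range n, y ^ (2 * i + 1) / (2 * i + 1)) ≤ Real.log a := by
  have := Real.sum_range_le_log_div h₀ h₁ n
  rw [h]
  linarith

/-- The exponent at the near-optimal tilting parameter `1.5063`. -/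
lemma tilted_exponent_le :
    Real.log (1 + 1.5063) - (1 + 0.14572049 * Real.log 4) / 2 * Real.log 1.5063
      ≤ 0.970359230 * Real.log 2 - 1 / 10 ^ 11 := by
  have h4 : Real.log 4 = 2 * Real.log 2 := by
    rw [show (4 : ℝ) = 2 ^ 2 by norm_num, Real.log_pow]
    norm_num
  have h2 := Real.log_two_gt_d9
  have hu : Real.log (1 + 1.5063) ≤ 0.918807562001 := by
    refine (log_le_of_eq_div (y := 15063 / 35063) (by norm_num) (by norm_num)
      (by norm_num) 20).trans ?_
    norm_num [sum_range_succ]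
  have hl : 0.409656312724 ≤ Real.log 1.5063 := by
    refine le_trans ?_ (le_log_of_eq_div (y := 5063 / 25063) (by norm_num) (by norm_num)
      (by norm_num) 9)
    norm_num [sum_range_succ]
  have hprod := mul_le_mul h2.le hl (by norm_num) (by linarith)
  rw [h4]
  linarith

/-- For large `N`, with `K = ⌊log N/log 3⌋ − 2` and `H = ⌊(K−1)·log 3/log 4⌋ + 2`, the
number of `n ≤ 2^(2H)` with `|s₂(n) − H| ≥ 0.14572049·(log 4)·H` is at most
`2^(0.970359230·2H) ≤ N^0.970359230`. -/
theorem tail_bound_s2_specific :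
    ∀ᶠ N : ℕ in atTop,
      ∀ K H : ℕ,
        K = ⌊Real.log N / Real.log 3⌋₊ - 2 →
        H = ⌊((K : ℝ) - 1) * Real.log 3 / Real.log 4⌋₊ + 2 →
        (((Finset.Iic (2 ^ (2 * H))).filter (fun n =>
            0.14572049 * Real.log 4 * H ≤ |(digitSum 2 n : ℝ) - (H : ℝ)|)).card : ℝ)
          ≤ (2 : ℝ) ^ (0.970359230 * (2 * H : ℝ)) ∧
        (2 : ℝ) ^ (0.970359230 * (2 * H : ℝ)) ≤ (N : ℝ) ^ (0.970359230 : ℝ) := by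
  have hlim : Tendsto (fun N : ℕ => Real.log N) atTop atTop :=
    Real.tendsto_log_atTop.comp tendsto_natCast_atTop_atTop
  have h3 : 0 < Real.log 3 := Real.log_pos (by norm_num)
  have h4 : 0 < Real.log 4 := Real.log_pos (by norm_num)
  filter_upwards [hlim.eventually_ge_atTop (4 * Real.log 3 + 10 ^ 11 * Real.log 4),
    eventually_gt_atTop 0] with N hN hN0 K H hK hH
  have hNR : (0 : ℝ) < N := by exact_mod_cast hN0
  have hfloor_le := Nat.floor_le (show 0 ≤ Real.log N / Real.log 3 by
    apply div_nonneg _ h3.le; linarith)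
  have hfloor_lt := Nat.lt_floor_add_one (Real.log N / Real.log 3)
  have h4div : 4 ≤ Real.log N / Real.log 3 := by
    rw [le_div_iff₀ h3]
    linarith
  have h2floor : 4 ≤ ⌊Real.log N / Real.log 3⌋₊ := Nat.le_floor (by exact_mod_cast h4div)
  have hKR : (K : ℝ) = (⌊Real.log N / Real.log 3⌋₊ : ℝ) - 2 := by
    rw [hK, Nat.cast_sub (by omega)]
    norm_num
  have hKle : ((K : ℝ) - 1) * Real.log 3 ≤ Real.log N - 3 * Real.log 3 := by
    have := (le_div_iff₀ h3).1 hfloor_le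
    rw [hKR]
    linarith
  have hKge : Real.log N - 4 * Real.log 3 ≤ ((K : ℝ) - 1) * Real.log 3 := by
    have := (div_lt_iff₀ h3).1 hfloor_lt
    rw [hKR]
    linarith
  have hHle : (H : ℝ) * Real.log 4 ≤ Real.log N := by
    have := Nat.floor_le (show 0 ≤ ((K : ℝ) - 1) * Real.log 3 / Real.log 4 by
      apply div_nonneg _ h4.le; linarith)
    have := (le_div_iff₀ h4).1 this
    have h1627 : 2 * Real.log 4 ≤ 3 * Real.log 3 := by
      have := Real.log_le_log (by norm_num) (show (4 : ℝ) ^ 2 ≤ 3 ^ 3 by norm_num)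
      rw [Real.log_pow, Real.log_pow] at this
      exact_mod_cast this
    rw [hH]
    push_cast
    linarith
  have hHge : (10 : ℝ) ^ 11 ≤ H := by
    have := (div_lt_iff₀ h4).1 (Nat.lt_floor_add_one (((K : ℝ) - 1) * Real.log 3 / Real.log 4))
    refine le_of_mul_le_mul_right ?_ h4
    rw [hH]
    push_cast
    linarith
  have h24 : Real.log 4 = 2 * Real.log 2 := by
    rw [show (4 : ℝ) = 2 ^ 2 by norm_num, Real.log_pow]
    norm_num
  constructor
  · have hsplit : Finset.Iic (2 ^ (2 * H)) = insert (2 ^ (2 * H)) (range (2 ^ (2 * H))) := by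
      ext n
      simp only [mem_Iic, mem_insert, mem_range]
      omega
    have hcard : (((Finset.Iic (2 ^ (2 * H))).filter (fun n =>
          0.14572049 * Real.log 4 * H ≤ |(digitSum 2 n : ℝ) - (H : ℝ)|)).card : ℝ)
        ≤ (((range (2 ^ (2 * H))).filter (fun n =>
          0.14572049 * Real.log 4 * H ≤ |(digitSum 2 n : ℝ) - (H : ℝ)|)).card : ℝ) + 1 := by
      rw [hsplit, filter_insert]
      split_ifs
      · exact_mod_cast card_insert_le _ _
      · linarith
    have hchernoff := card_digitSum_two_deviation_le (x := 1.5063) (by norm_num)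
      (0.14572049 * Real.log 4) H
    set β := 0.970359230 * Real.log 2 with hβ
    have hexp := Real.exp_le_exp.2
      (mul_le_mul_of_nonneg_left tilted_exponent_le (show (0 : ℝ) ≤ 2 * H by positivity))
    rw [← hβ] at hexp
    have hβpos : 0 ≤ β - 1 / 10 ^ 11 := by
      have := Real.log_two_gt_d9
      rw [hβ]
      linarith
    have hone := Real.one_le_exp (mul_nonneg (show (0 : ℝ) ≤ 2 * H by positivity) hβpos)
    have hthree : 3 ≤ Real.exp (2 * H * (1 / 10 ^ 11)) := by
      have := Real.add_one_le_exp ((2 : ℝ) * H * (1 / 10 ^ 11))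
      linarith
    have hprod := mul_le_mul_of_nonneg_right hthree
      (Real.exp_pos (2 * H * (β - 1 / 10 ^ 11))).le
    rw [← Real.exp_add] at hprod
    have hrpow : (2 : ℝ) ^ (0.970359230 * (2 * H : ℝ)) =
        Real.exp (2 * H * (1 / 10 ^ 11) + 2 * H * (β - 1 / 10 ^ 11)) := by
      rw [Real.rpow_def_of_pos two_pos, hβ]
      congr 1
      ring
    rw [hrpow]
    linarith
  · rw [Real.rpow_def_of_pos two_pos, Real.rpow_def_of_pos hNR]
    apply Real.exp_le_exp.2
    rw [h24] at hHle
    linarith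
end
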